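/- arXiv:2010.09775 — 6 statements merged into one kernel-verified Lean document; each statement's English description precedes it below -/
import Mathlib

section
/- For natural numbers a, b and m ≤ min(a, b), the number of a × b matrices over F₂ of rank exactly m equals ∏_{k=0}^{m−1} (2^a − 2^k)(2^b − 2^k) / ∏_{k=0}^{m−1} (2^m − 2^k); equivalently, (∏_{k=0}^{m−1} (2^m − 2^k)) · #{a × b matrices over F₂ of rank m} = ∏_{k=0}^{m−1} (2^a − 2^k)(2^b − 2^k). -/
open Module

namespace Matrix

section Factorization

variable {K m n r : Type*} [Field K] [Fintype r]

theorem mul_left_cancel_of_linearIndependent_col {S : Matrix m r K}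
    (hS : LinearIndependent K S.col) {T T' : Matrix r n K} (h : S * T = S * T') : T = T' := by
  refine Matrix.ext_col fun j => mulVec_injective_iff.2 hS ?_
  exact congrFun (congrArg Matrix.col h) j

variable [Fintype n]

theorem linearIndependent_row_iff_rank_eq_card {M : Matrix r n K} :
    LinearIndependent K M.row ↔ M.rank = Fintype.card r := by
  rw [linearIndependent_iff_card_eq_finrank_span, rank_eq_finrank_span_row, Set.finrank, eq_comm]

theorem rank_mul_eq_right_of_linearIndependent_col {S : Matrix m r K}
    (hS : LinearIndependent K S.col) (T : Matrix r n K) : (S * T).rank = T.rank := by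
  rw [rank, rank, mulVecLin_mul, LinearMap.range_comp,
    ← (Submodule.equivMapOfInjective S.mulVecLin (mulVec_injective_iff.2 hS) _).finrank_eq]

theorem range_mul_eq_of_linearIndependent {S : Matrix m r K} {T : Matrix r n K}
    (hT : LinearIndependent K T.row) :
    LinearMap.range (S * T).mulVecLin = LinearMap.range S.mulVecLin := by
  rw [mulVecLin_mul]
  refine LinearMap.range_comp_of_range_eq_top _ (Submodule.eq_top_of_finrank_eq ?_)
  rw [finrank_fintype_fun_eq_card]
  exact linearIndependent_row_iff_rank_eq_card.1 hT

/-- If the columns of `S` form a basis of the column space of `A`, then `A` factors through `S`. -/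
theorem exists_eq_mul_of_col_mem_range {A : Matrix m n K} [Finite m] (hA : A.rank = Fintype.card r)
    {S : Matrix m r K} (hS : LinearIndependent K S.col)
    (hmem : ∀ j, S.col j ∈ LinearMap.range A.mulVecLin) : ∃ T : Matrix r n K, S * T = A := by
  classical
  have hle : LinearMap.range S.mulVecLin ≤ LinearMap.range A.mulVecLin := by
    rw [range_mulVecLin, Submodule.span_le]
    rintro _ ⟨j, rfl⟩
    exact hmem j
  have heq : LinearMap.range S.mulVecLin = LinearMap.range A.mulVecLin := by
    refine Submodule.eq_of_le_of_finrank_eq hle ?_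
    rw [range_mulVecLin, finrank_span_eq_card hS]
    exact hA.symm
  have hcol (j : n) : ∃ v, S *ᵥ v = A.col j := by
    have : A.col j ∈ LinearMap.range S.mulVecLin := by
      rw [heq, range_mulVecLin]
      exact Submodule.subset_span ⟨j, rfl⟩
    exact this
  choose v hv using hcol
  exact ⟨(Matrix.of v)ᵀ, Matrix.ext_col hv⟩

/-- Factorizations of `A` into a matrix with independent columns and a matrix with independent rows,
with inner dimension the rank of `A`, correspond to bases of the column space of `A`. -/
noncomputable def rankFactorizationEquiv [Finite m] (A : Matrix m n K)
    (hA : A.rank = Fintype.card r) :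
    {p : {S : Matrix m r K // LinearIndependent K S.col} ×
      {T : Matrix r n K // LinearIndependent K T.row} // p.1.1 * p.2.1 = A} ≃
    {s : r → LinearMap.range A.mulVecLin // LinearIndependent K s} :=
  Equiv.ofBijective
    (fun p => ⟨fun j => ⟨p.1.1.1.col j, by
        have h := range_mul_eq_of_linearIndependent (S := p.1.1.1) p.1.2.2
        rw [congrArg (fun B : Matrix m n K => LinearMap.range B.mulVecLin) p.2] at h
        rw [h, range_mulVecLin]
        exact Submodule.subset_span ⟨j, rfl⟩⟩,
      LinearIndependent.of_comp (Submodule.subtype _) p.1.1.2⟩) <| by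
    constructor
    · rintro ⟨⟨⟨S, hS⟩, ⟨T, hT⟩⟩, h⟩ ⟨⟨⟨S', hS'⟩, ⟨T', hT'⟩⟩, h'⟩ heq
      have hSS : S = S' := Matrix.ext_col fun j =>
        congrArg Subtype.val (congrFun (congrArg Subtype.val heq) j)
      subst hSS
      have hTT : T = T' := mul_left_cancel_of_linearIndependent_col hS (h.trans h'.symm)
      subst hTT
      rfl
    · rintro ⟨s, hs⟩
      let S : Matrix m r K := (Matrix.of fun j => (s j : m → K))ᵀ
      have hS : LinearIndependent K S.col :=
        hs.map' (Submodule.subtype _) (Submodule.ker_subtype _)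
      obtain ⟨T, hT⟩ := exists_eq_mul_of_col_mem_range hA hS fun j => (s j).2
      have hTrow : LinearIndependent K T.row := by
        rw [linearIndependent_row_iff_rank_eq_card, ← hA, ← hT,
          rank_mul_eq_right_of_linearIndependent_col hS]
      exact ⟨⟨⟨⟨S, hS⟩, ⟨T, hTrow⟩⟩, hT⟩, rfl⟩

end Factorization

/-- The number of matrices of rank `r` over a finite field, in multiplicative form. -/
theorem prod_mul_card_rank_eq {K : Type*} [Field K] [Fintype K] {a b r : ℕ}
    (ha : r ≤ a) (hb : r ≤ b) :
    (∏ k : Fin r, (Fintype.card K ^ r - Fintype.card K ^ (k : ℕ))) *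
      Nat.card {A : Matrix (Fin a) (Fin b) K // A.rank = r} =
    (∏ k : Fin r, (Fintype.card K ^ a - Fintype.card K ^ (k : ℕ))) *
      ∏ k : Fin r, (Fintype.card K ^ b - Fintype.card K ^ (k : ℕ)) := by
  classical
  have hrow {c : ℕ} (hc : r ≤ c) :
      Nat.card {T : Matrix (Fin r) (Fin c) K // LinearIndependent K T.row} =
        ∏ k : Fin r, (Fintype.card K ^ c - Fintype.card K ^ (k : ℕ)) := by
    have := card_linearIndependent (K := K) (V := Fin c → K) (k := r) (by simpa using hc)
    rwa [finrank_fin_fun] at this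
  have hcol : Nat.card {S : Matrix (Fin a) (Fin r) K // LinearIndependent K S.col} =
      ∏ k : Fin r, (Fintype.card K ^ a - Fintype.card K ^ (k : ℕ)) := by
    rw [← hrow ha]
    exact Nat.card_congr ((transposeAddEquiv (Fin a) (Fin r) K).toEquiv.subtypeEquiv
      fun _ => Iff.rfl)
  let f (p : {S : Matrix (Fin a) (Fin r) K // LinearIndependent K S.col} ×
      {T : Matrix (Fin r) (Fin b) K // LinearIndependent K T.row}) :
      {A : Matrix (Fin a) (Fin b) K // A.rank = r} :=
    ⟨p.1.1 * p.2.1, by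
      rw [rank_mul_eq_right_of_linearIndependent_col p.1.2,
        linearIndependent_row_iff_rank_eq_card.1 p.2.2, Fintype.card_fin]⟩
  have hfiber (A : {A : Matrix (Fin a) (Fin b) K // A.rank = r}) :
      Nat.card {p // f p = A} = ∏ k : Fin r, (Fintype.card K ^ r - Fintype.card K ^ (k : ℕ)) := by
    have hA : finrank K (LinearMap.range A.1.mulVecLin) = r := A.2
    rw [Nat.card_congr ((Equiv.subtypeEquivRight fun p => Subtype.ext_iff).trans
        (rankFactorizationEquiv (r := Fin r) A.1 (by simpa using A.2))),
      card_linearIndependent hA.ge, hA]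
  rw [← hcol, ← hrow hb, ← Nat.card_prod, ← Nat.card_congr (Equiv.sigmaFiberEquiv f),
    Nat.card_sigma, Finset.sum_congr rfl fun A _ => hfiber A, Finset.sum_const, smul_eq_mul,
    Finset.card_univ, Nat.card_eq_fintype_card, mul_comm]

end Matrix

/-- For natural numbers `a, b` and `m ≤ min a b`, the number of `a × b`
matrices over `F₂ = ZMod 2` of rank exactly `m` equals
`∏_{k=0}^{m-1} (2^a - 2^k)(2^b - 2^k) / ∏_{k=0}^{m-1} (2^m - 2^k)`,
stated multiplicatively:
`(∏_{k<m} (2^m - 2^k)) · #{a × b matrices of rank m} = ∏_{k<m} (2^a - 2^k)(2^b - 2^k)`. -/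
theorem count_rank_m_matrices (a b m : ℕ) (h : m ≤ min a b) :
    (∏ k ∈ Finset.range m, (2 ^ m - 2 ^ k)) *
      Nat.card {A : Matrix (Fin a) (Fin b) (ZMod 2) // A.rank = m} =
      ∏ k ∈ Finset.range m, ((2 ^ a - 2 ^ k) * (2 ^ b - 2 ^ k)) := by
  rw [Finset.prod_mul_distrib]
  simpa only [ZMod.card, Finset.prod_range] using
    Matrix.prod_mul_card_rank_eq (K := ZMod 2) (h.trans (min_le_left a b))
      (h.trans (min_le_right a b))
end

section
/- Let M be a uniformly random a × b matrix over F₂ (each of the 2^{ab} matrices having equal probability). Then the expected value of 2^{rank M} equals (1/2^{ab}) · Σ_{m=0}^{min(a,b)} 2^m · ∏_{k=0}^{m−1} (2^a − 2^k)(2^b − 2^k) / ∏_{k=0}^{m−1} (2^m − 2^k). In particular, with a = 2n_e rows (one pair per erased qubit) and b = n_s columns (one per stabilizer generator), the RMT-ansatz average perfect-recovery probability 𝔼[2^{rank M − 2n_e}] of a random stabilizer code under erasure of n_e qubits equals 2^{−2 n_e n_s − 2 n_e} Σ_{m=0}^{min(n_s, 2n_e)} 2^m ∏_{k=0}^{m−1}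 (2^{2n_e} − 2^k)(2^{n_s} − 2^k) / ∏_{k=0}^{m−1} (2^m − 2^k). -/
namespace Matrix

section Factorization

variable {K : Type*} [Field K] {a b m : ℕ}

theorem linearIndependent_row_iff_rank_eq (A : Matrix (Fin m) (Fin b) K) :
    LinearIndependent K A.row ↔ A.rank = m := by
  rw [linearIndependent_iff_card_eq_finrank_span, Fintype.card_fin, rank_eq_finrank_span_row,
    Set.finrank, eq_comm]

theorem rank_transpose_mul_of_linearIndependent_row {C : Matrix (Fin m) (Fin a) K}
    (hC : LinearIndependent K C.row) (R : Matrix (Fin m) (Fin b) K) :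
    (Cᵀ * R).rank = R.rank := by
  have h : Function.Injective Cᵀ.mulVecLin := mulVec_injective_iff.2 hC
  rw [rank, mulVecLin_mul, LinearMap.range_comp, rank]
  exact (Submodule.equivMapOfInjective _ h _).finrank_eq.symm

/-- Factorizations `M = Cᵀ * R` through matrices with `m` linearly independent rows. -/
abbrev RankFactorization (m : ℕ) (M : Matrix (Fin a) (Fin b) K) : Type _ :=
  {p : {C : Matrix (Fin m) (Fin a) K // LinearIndependent K C.row} ×
      {R : Matrix (Fin m) (Fin b) K // LinearIndependent K R.row} // p.1.1ᵀ * p.2.1 = M}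

theorem row_mem_span_of_mul_eq {C : Matrix (Fin a) (Fin m) K} {R : Matrix (Fin m) (Fin b) K}
    (i : Fin a) : (C * R).row i ∈ Submodule.span K (Set.range R.row) := by
  rw [← range_vecMulLinear]
  exact ⟨C i, rfl⟩

theorem span_row_eq_of_mul_eq {C : Matrix (Fin a) (Fin m) K} {R : Matrix (Fin m) (Fin b) K}
    (h : (C * R).rank = R.rank) :
    Submodule.span K (Set.range (C * R).row) = Submodule.span K (Set.range R.row) := by
  apply Submodule.eq_of_le_of_finrank_eq
  · rw [Submodule.span_le]
    rintro _ ⟨i, rfl⟩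
    exact row_mem_span_of_mul_eq i
  · rw [← rank_eq_finrank_span_row, ← rank_eq_finrank_span_row, h]

/-- The second factor of a rank factorization of `M`, as a tuple of vectors in the row space. -/
def RankFactorization.rowTuple {M : Matrix (Fin a) (Fin b) K} (p : RankFactorization m M) :
    {v : Fin m → Submodule.span K (Set.range M.row) // LinearIndependent K v} :=
  ⟨fun i ↦ ⟨p.1.2.1 i, by
      obtain ⟨⟨⟨C, hC⟩, ⟨R, hR⟩⟩, rfl⟩ := p
      rw [span_row_eq_of_mul_eq (rank_transpose_mul_of_linearIndependent_row hC R)]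
      exact Submodule.subset_span ⟨i, rfl⟩⟩,
    LinearIndependent.of_comp (Submodule.subtype _) p.1.2.2⟩

theorem RankFactorization.rowTuple_bijective {M : Matrix (Fin a) (Fin b) K} (hM : M.rank = m) :
    Function.Bijective (rowTuple (m := m) (M := M)) := by
  constructor
  · rintro ⟨⟨⟨C, hC⟩, ⟨R, hR⟩⟩, h⟩ ⟨⟨⟨C', hC'⟩, ⟨R', hR'⟩⟩, h'⟩ hp
    have hRR : R = R' := by
      funext i
      exact congrArg Subtype.val (congrFun (congrArg Subtype.val hp) i)
    subst hRR
    have hCC : Cᵀ = C'ᵀ := by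
      funext i
      apply vecMul_injective_iff.2 hR
      exact congrFun (h.trans h'.symm) i
    have hCC' : C = C' := transpose_injective hCC
    subst hCC'
    rfl
  · rintro ⟨v, hv⟩
    let R : Matrix (Fin m) (Fin b) K := fun i ↦ v i
    have hR : LinearIndependent K R.row :=
      hv.map' (Submodule.subtype _) (Submodule.ker_subtype _)
    have hspan : Submodule.span K (Set.range M.row) = Submodule.span K (Set.range R.row) := by
      symm
      apply Submodule.eq_of_le_of_finrank_eq
      · rw [Submodule.span_le]
        rintro _ ⟨i, rfl⟩
        exact (v i).2
      · rw [← rank_eq_finrank_span_row, ← rank_eq_finrank_span_row, hM,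
          (linearIndependent_row_iff_rank_eq R).1 hR]
    have hrow (i : Fin a) : ∃ c, c ᵥ* R = M i := by
      have : M.row i ∈ Submodule.span K (Set.range R.row) :=
        hspan ▸ Submodule.subset_span ⟨i, rfl⟩
      rwa [← range_vecMulLinear] at this
    choose C hC using hrow
    have hCR : of C * R = M := funext hC
    have hrank : (of C)ᵀ.rank = m := by
      rw [rank_transpose]
      refine le_antisymm (rank_le_width _) ?_
      have hle := rank_mul_le_left (of C) R
      rwa [hCR, hM] at hle
    exact ⟨⟨⟨⟨(of C)ᵀ, (linearIndependent_row_iff_rank_eq _).2 hrank⟩, ⟨R, hR⟩⟩, hCR⟩, rfl⟩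

variable [Fintype K]

theorem card_rankFactorization {M : Matrix (Fin a) (Fin b) K} (hM : M.rank = m) :
    Nat.card (RankFactorization m M) =
      ∏ i : Fin m, (Fintype.card K ^ m - Fintype.card K ^ i.val) := by
  have hfin : Module.finrank K (Submodule.span K (Set.range M.row)) = m := by
    rw [← rank_eq_finrank_span_row, hM]
  rw [Nat.card_congr (Equiv.ofBijective _ (RankFactorization.rowTuple_bijective hM)),
    card_linearIndependent hfin.ge, hfin]

/-- The number of `a × b` matrices of rank `m` over a finite field, in product form. -/
theorem card_rank_eq_mul (ha : m ≤ a) (hb : m ≤ b) :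
    Nat.card {M : Matrix (Fin a) (Fin b) K // M.rank = m} *
        ∏ i : Fin m, (Fintype.card K ^ m - Fintype.card K ^ i.val) =
      (∏ i : Fin m, (Fintype.card K ^ a - Fintype.card K ^ i.val)) *
        ∏ i : Fin m, (Fintype.card K ^ b - Fintype.card K ^ i.val) := by
  classical
  let Φ : {C : Matrix (Fin m) (Fin a) K // LinearIndependent K C.row} ×
      {R : Matrix (Fin m) (Fin b) K // LinearIndependent K R.row} →
      {M : Matrix (Fin a) (Fin b) K // M.rank = m} := fun p ↦
    ⟨p.1.1ᵀ * p.2.1, (rank_transpose_mul_of_linearIndependent_row p.1.2 _).trans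
      ((linearIndependent_row_iff_rank_eq _).1 p.2.2)⟩
  have hfiber (M : {M : Matrix (Fin a) (Fin b) K // M.rank = m}) :
      Nat.card {p // Φ p = M} = ∏ i : Fin m, (Fintype.card K ^ m - Fintype.card K ^ i.val) := by
    rw [← card_rankFactorization M.2]
    exact Nat.card_congr (Equiv.subtypeEquivRight fun p ↦ Subtype.ext_iff)
  have hcard (n : ℕ) (hn : m ≤ n) :
      Nat.card {C : Matrix (Fin m) (Fin n) K // LinearIndependent K C.row} =
        ∏ i : Fin m, (Fintype.card K ^ n - Fintype.card K ^ i.val) := by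
    have h := card_linearIndependent (K := K) (V := Fin n → K) (k := m) (by simpa using hn)
    rwa [Module.finrank_fin_fun] at h
  rw [← hcard a ha, ← hcard b hb, ← Nat.card_prod, ← Nat.card_congr (Equiv.sigmaFiberEquiv Φ),
    Nat.card_sigma, Finset.sum_congr rfl fun M _ ↦ hfiber M, Finset.sum_const,
    Finset.card_univ, Nat.card_eq_fintype_card, smul_eq_mul]

end Factorization

theorem card_rank_eq_div {a b m : ℕ} (ha : m ≤ a) (hb : m ≤ b) :
    (Nat.card {M : Matrix (Fin a) (Fin b) (ZMod 2) // M.rank = m} : ℝ) =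
      (∏ k ∈ Finset.range m, (((2 : ℝ) ^ a - 2 ^ k) * ((2 : ℝ) ^ b - 2 ^ k))) /
        ∏ k ∈ Finset.range m, ((2 : ℝ) ^ m - 2 ^ k) := by
  have hcast (n : ℕ) (hn : m ≤ n) :
      ((∏ i : Fin m, (2 ^ n - 2 ^ i.val) : ℕ) : ℝ) =
        ∏ k ∈ Finset.range m, ((2 : ℝ) ^ n - 2 ^ k) := by
    rw [Finset.prod_range, Nat.cast_prod]
    refine Finset.prod_congr rfl fun i _ ↦ ?_
    rw [Nat.cast_sub (Nat.pow_le_pow_right two_pos (i.2.le.trans hn))]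
    push_cast
    rfl
  have h := card_rank_eq_mul (K := ZMod 2) ha hb
  rw [ZMod.card] at h
  rw [eq_div_iff, Finset.prod_mul_distrib, ← hcast a ha, ← hcast b hb, ← hcast m le_rfl]
  · exact_mod_cast h
  · refine Finset.prod_ne_zero_iff.2 fun k hk ↦ (sub_pos.2 ?_).ne'
    exact pow_lt_pow_right₀ one_lt_two (Finset.mem_range.1 hk)

theorem sum_two_pow_rank (a b : ℕ) :
    ∑ M : Matrix (Fin a) (Fin b) (ZMod 2), (2 : ℝ) ^ M.rank =
      ∑ m ∈ Finset.range (min a b + 1),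
        (2 : ℝ) ^ m *
          ((∏ k ∈ Finset.range m, (((2 : ℝ) ^ a - 2 ^ k) * ((2 : ℝ) ^ b - 2 ^ k))) /
            ∏ k ∈ Finset.range m, ((2 : ℝ) ^ m - 2 ^ k)) := by
  rw [← Finset.sum_fiberwise_of_maps_to (g := rank) (t := Finset.range (min a b + 1))
    fun M _ ↦ Finset.mem_range_succ_iff.2 (le_min (rank_le_height M) (rank_le_width M))]
  refine Finset.sum_congr rfl fun m hm ↦ ?_
  have hm' := le_min_iff.1 (Finset.mem_range_succ_iff.1 hm)
  rw [← card_rank_eq_div hm'.1 hm'.2, Nat.card_eq_fintype_card, Fintype.card_subtype,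
    Finset.sum_congr rfl fun M hM ↦ by rw [(Finset.mem_filter.1 hM).2], Finset.sum_const,
    nsmul_eq_mul, mul_comm]

end Matrix

/-- For a uniformly random `a × b` matrix `M` over `F₂ = ZMod 2`
(each of the `2^{ab}` matrices having equal probability), the expected value of
`2^{rank M}` equals
`(1/2^{ab}) · Σ_{m=0}^{min(a,b)} 2^m · ∏_{k<m} (2^a - 2^k)(2^b - 2^k) / ∏_{k<m} (2^m - 2^k)`.
In particular, with `a = 2 n_e` rows and `b = n_s` columns, the RMT-ansatz average
perfect-recovery probability `𝔼[2^{rank M - 2 n_e}]` of a random stabilizer code under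
erasure of `n_e` qubits equals
`2^{-2 n_e n_s - 2 n_e} Σ_{m=0}^{min(n_s, 2 n_e)} 2^m ∏_{k<m} (2^{2n_e} - 2^k)(2^{n_s} - 2^k) / ∏_{k<m} (2^m - 2^k)`. -/
theorem expected_two_pow_rank (a b n_e n_s : ℕ) :
    ((∑ M : Matrix (Fin a) (Fin b) (ZMod 2), (2 : ℝ) ^ M.rank) / 2 ^ (a * b) =
      (1 / 2 ^ (a * b)) * ∑ m ∈ Finset.range (min a b + 1),
        (2 : ℝ) ^ m *
          ((∏ k ∈ Finset.range m, (((2 : ℝ) ^ a - 2 ^ k) * ((2 : ℝ) ^ b - 2 ^ k))) /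
            ∏ k ∈ Finset.range m, ((2 : ℝ) ^ m - 2 ^ k))) ∧
    ((∑ M : Matrix (Fin (2 * n_e)) (Fin n_s) (ZMod 2), (2 : ℝ) ^ M.rank / 2 ^ (2 * n_e)) /
        2 ^ (2 * n_e * n_s) =
      (2 : ℝ) ^ (-(2 * (n_e : ℤ) * n_s + 2 * n_e)) *
        ∑ m ∈ Finset.range (min n_s (2 * n_e) + 1),
          (2 : ℝ) ^ m *
            ((∏ k ∈ Finset.range m,
                (((2 : ℝ) ^ (2 * n_e) - 2 ^ k) * ((2 : ℝ) ^ n_s - 2 ^ k))) /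
              ∏ k ∈ Finset.range m, ((2 : ℝ) ^ m - 2 ^ k))) := by
  constructor
  · rw [Matrix.sum_two_pow_rank, div_eq_mul_one_div, mul_comm]
  · rw [← Finset.sum_div, Matrix.sum_two_pow_rank, min_comm, zpow_neg, div_div, ← pow_add,
      div_eq_inv_mul]
    congr 2
    rw [← zpow_natCast]
    congr 1
    push_cast
    ring
end

section
/- Let M_n be a uniformly random n × n matrix over F₂. Then the expected recovery probability 𝔼[2^{rank M_n − n}] converges as n → ∞ to the critical recovery rate r_c = Σ_{m=0}^{∞} [∏_{k=1}^{∞} (1 − 2^{−(m+k)})²] / [2^{m(m+1)} ∏_{k=1}^{∞} (1 − 2^{−k})]. -/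
open Filter

/-- The number of `a`-tuples of vectors spanning a subspace of dimension `r`, in a space with `Q`
elements over a field with `q` elements. -/
noncomputable def rankCount (q Q : ℝ) (a r : ℕ) : ℝ :=
  ∏ i ∈ Finset.range r, (Q - q ^ i) * (q ^ a - q ^ i) / (q ^ r - q ^ i)

section RankCount

open Finset

variable {q : ℝ}

lemma rankCount_eq_div (q Q : ℝ) (a r : ℕ) :
    rankCount q Q a r =
      (∏ i ∈ range r, (Q - q ^ i)) * (∏ i ∈ range r, (q ^ a - q ^ i)) /
        ∏ i ∈ range r, (q ^ r - q ^ i) := by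
  rw [rankCount, prod_div_distrib, prod_mul_distrib]

lemma prod_range_succ_pow_succ_sub (q : ℝ) (a r : ℕ) :
    ∏ i ∈ range (r + 1), (q ^ (a + 1) - q ^ i) =
      (q ^ (a + 1) - 1) * q ^ r * ∏ i ∈ range r, (q ^ a - q ^ i) := by
  rw [prod_range_succ']
  have h (i : ℕ) : q ^ (a + 1) - q ^ (i + 1) = q * (q ^ a - q ^ i) := by ring
  simp_rw [h, prod_mul_distrib]
  simp
  ring

lemma prod_pow_sub_pos (hq : 1 < q) (r : ℕ) : 0 < ∏ i ∈ range r, (q ^ r - q ^ i) :=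
  prod_pos fun _ hi => sub_pos.2 (pow_lt_pow_right₀ hq (mem_range.1 hi))

@[simp]
lemma rankCount_zero (q Q : ℝ) (a : ℕ) : rankCount q Q a 0 = 1 := by
  simp [rankCount]

lemma rankCount_self_succ (q Q : ℝ) (a : ℕ) : rankCount q Q a (a + 1) = 0 :=
  prod_eq_zero (self_mem_range_succ a) (by simp)

lemma rankCount_succ_succ (hq : 1 < q) (Q : ℝ) (a r : ℕ) :
    rankCount q Q (a + 1) (r + 1) =
      rankCount q Q a (r + 1) * q ^ (r + 1) + rankCount q Q a r * (Q - q ^ r) := by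
  simp only [rankCount_eq_div, prod_range_succ_pow_succ_sub]
  rw [prod_range_succ _ r, prod_range_succ _ r]
  have hD := (prod_pow_sub_pos hq r).ne'
  have h1 : q ^ (r + 1) - 1 ≠ 0 := (sub_pos.2 (one_lt_pow₀ hq r.succ_ne_zero)).ne'
  have h2 : q ^ r ≠ 0 := by positivity
  field_simp
  ring

lemma sum_rankCount_succ (hq : 1 < q) (Q : ℝ) (a : ℕ) (f : ℕ → ℝ) :
    ∑ r ∈ range (a + 2), rankCount q Q (a + 1) r * f r =
      ∑ r ∈ range (a + 1),
        rankCount q Q a r * (q ^ r * f r + (Q - q ^ r) * f (r + 1)) := by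
  have h : ∑ r ∈ range (a + 2), rankCount q Q a r * (q ^ r * f r) =
      ∑ r ∈ range (a + 1), rankCount q Q a r * (q ^ r * f r) := by
    rw [sum_range_succ, rankCount_self_succ, zero_mul, add_zero]
  rw [sum_range_succ'] at h ⊢
  simp only [rankCount_succ_succ hq, mul_add, sum_add_distrib, ← h, rankCount_zero, add_mul]
  simp only [mul_assoc, pow_zero, one_mul]
  ring

end RankCount

section SpanRank

open Finset Module

variable {K V : Type*} [Field K] [AddCommGroup V] [Module K V]

lemma finrank_span_insert_of_notMem [FiniteDimensional K V] {s : Set V} {x : V}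
    (hx : x ∉ Submodule.span K s) :
    finrank K (Submodule.span K (insert x s)) = finrank K (Submodule.span K s) + 1 := by
  rw [Submodule.span_insert, sup_comm, Submodule.finrank_sup_span_singleton hx]

variable [Fintype K] [Fintype V]

lemma sum_finrank_span_insert (s : Set V) (f : ℕ → ℝ) :
    ∑ x : V, f (finrank K (Submodule.span K (insert x s))) =
      (Fintype.card K : ℝ) ^ finrank K (Submodule.span K s) * f (finrank K (Submodule.span K s)) +
        ((Fintype.card V : ℝ) - (Fintype.card K : ℝ) ^ finrank K (Submodule.span K s)) *
          f (finrank K (Submodule.span K s) + 1) := by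
  classical
  have hc : #{x : V | x ∈ Submodule.span K s} =
      Fintype.card K ^ finrank K (Submodule.span K s) := by
    rw [← Module.card_eq_pow_finrank (K := K) (V := Submodule.span K s), Fintype.card_subtype]
  have hc' : (#{x : V | x ∉ Submodule.span K s} : ℝ) =
      (Fintype.card V : ℝ) - (Fintype.card K : ℝ) ^ finrank K (Submodule.span K s) := by
    rw [eq_sub_iff_add_eq, ← Nat.cast_pow, ← hc, add_comm]
    exact_mod_cast card_filter_add_card_filter_not (s := univ) (· ∈ Submodule.span K s)
  rw [← sum_filter_add_sum_filter_not univ (· ∈ Submodule.span K s)]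
  congr 1
  · rw [sum_congr rfl (g := fun _ => f (finrank K (Submodule.span K s))), sum_const, hc,
      nsmul_eq_mul, Nat.cast_pow]
    intro x hx
    rw [Submodule.span_insert_eq_span (mem_filter.1 hx).2]
  · rw [sum_congr rfl (g := fun _ => f (finrank K (Submodule.span K s) + 1)), sum_const,
      nsmul_eq_mul, hc']
    intro x hx
    rw [finrank_span_insert_of_notMem (mem_filter.1 hx).2]

lemma sum_finrank_span_range (a : ℕ) (f : ℕ → ℝ) :
    ∑ v : Fin a → V, f (finrank K (Submodule.span K (Set.range v))) =
      ∑ r ∈ range (a + 1), rankCount (Fintype.card K) (Fintype.card V) a r * f r := by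
  have hq : (1 : ℝ) < Fintype.card K := by exact_mod_cast Fintype.one_lt_card
  induction a generalizing f with
  | zero =>
    rw [Fintype.sum_unique, Set.range_eq_empty, Submodule.span_empty, finrank_bot]
    simp
  | succ a ih =>
    rw [sum_rankCount_succ hq, ← ih, ← (Fin.consEquiv fun _ => V).sum_comp,
      Fintype.sum_prod_type_right]
    refine sum_congr rfl fun v _ => ?_
    rw [← sum_finrank_span_insert]
    refine sum_congr rfl fun x _ => ?_
    rw [← Fin.range_cons]
    rfl

lemma sum_matrix_rank (a b : ℕ) (f : ℕ → ℝ) :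
    ∑ M : Matrix (Fin a) (Fin b) K, f M.rank =
      ∑ r ∈ range (a + 1), rankCount (Fintype.card K) (Fintype.card K ^ b) a r * f r := by
  have h := sum_finrank_span_range (K := K) (V := Fin b → K) a f
  simp only [Fintype.card_pi, prod_const, card_univ, Fintype.card_fin, Nat.cast_pow] at h
  rw [← h]
  refine sum_congr rfl fun M _ => ?_
  rw [M.rank_eq_finrank_span_row]
  rfl

end SpanRank

/-- The finite product `∏_{k=1}^N (1 - 2^{-(m+k)})`. -/
noncomputable def eulerPartial (m N : ℕ) : ℝ :=
  ∏ k ∈ Finset.range N, (1 - ((2 : ℝ) ^ (m + (k + 1)))⁻¹)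

section EulerPartial

open Finset

lemma prod_two_pow_sub (m r : ℕ) :
    ∏ i ∈ range r, ((2 : ℝ) ^ (m + r) - 2 ^ i) = 2 ^ ((m + r) * r) * eulerPartial m r := by
  rw [← prod_range_reflect, eulerPartial, pow_mul, pow_eq_prod_const _ r, ← prod_mul_distrib]
  refine prod_congr rfl fun k hk => ?_
  obtain ⟨j, rfl⟩ := Nat.exists_eq_add_of_lt (mem_range.1 hk)
  have h : k + j + 1 - 1 - k = j := by omega
  rw [h, show m + (k + j + 1) = j + (m + (k + 1)) by omega, pow_add]
  field_simp

lemma one_sub_inv_two_pow_mem (j : ℕ) : 1 - ((2 : ℝ) ^ j)⁻¹ ∈ Set.Icc 0 1 := by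
  have h := inv_le_one_of_one_le₀ (one_le_pow₀ (one_le_two (α := ℝ)) (n := j))
  exact ⟨by linarith, by linarith [show (0 : ℝ) ≤ (2 ^ j)⁻¹ by positivity]⟩

lemma eulerPartial_nonneg (m N : ℕ) : 0 ≤ eulerPartial m N :=
  prod_nonneg fun _ _ => (one_sub_inv_two_pow_mem _).1

lemma eulerPartial_le_one (m N : ℕ) : eulerPartial m N ≤ 1 :=
  prod_le_one (fun _ _ => (one_sub_inv_two_pow_mem _).1) fun _ _ => (one_sub_inv_two_pow_mem _).2

lemma quarter_le_eulerPartial (N : ℕ) : 1 / 4 ≤ eulerPartial 0 N := by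
  have key (N : ℕ) : 1 / 4 + ((2 : ℝ) ^ (N + 2))⁻¹ ≤ eulerPartial 0 (N + 1) := by
    induction N with
    | zero => norm_num [eulerPartial]
    | succ N ih =>
      rw [eulerPartial, prod_range_succ, ← eulerPartial, show 0 + (N + 1 + 1) = N + 2 by omega,
        show N + 1 + 2 = N + 2 + 1 by omega, pow_succ _ (N + 2), mul_inv]
      have h0 : (0 : ℝ) < (2 ^ (N + 2))⁻¹ := by positivity
      have h1 : ((2 : ℝ) ^ (N + 2))⁻¹ ≤ 1 / 4 := by
        rw [one_div]
        exact inv_anti₀ (by norm_num)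
          (by nlinarith [one_le_pow₀ (one_le_two (α := ℝ)) (n := N), pow_add (2 : ℝ) N 2])
      nlinarith [mul_le_mul_of_nonneg_right ih (one_sub_inv_two_pow_mem (N + 2)).1]
  cases N with
  | zero => norm_num [eulerPartial]
  | succ N => exact le_trans (by linarith [show (0 : ℝ) < (2 ^ (N + 2))⁻¹ by positivity]) (key N)

lemma multipliable_one_sub_inv_two_pow (m : ℕ) :
    Multipliable fun k : ℕ => 1 - ((2 : ℝ) ^ (m + (k + 1)))⁻¹ := by
  have h : Summable fun k : ℕ => -((2 : ℝ) ^ (m + (k + 1)))⁻¹ := by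
    refine (((summable_geometric_two).mul_left ((1 / 2 : ℝ) ^ (m + 1))).neg).congr fun k => ?_
    rw [← pow_add, one_div, inv_pow]
    congr 3
    omega
  simpa only [sub_eq_add_neg] using Real.multipliable_one_add_of_summable h

lemma tendsto_eulerPartial (m : ℕ) :
    Tendsto (eulerPartial m) atTop (nhds (∏' k : ℕ, (1 - ((2 : ℝ) ^ (m + (k + 1)))⁻¹))) :=
  (multipliable_one_sub_inv_two_pow m).hasProd.tendsto_prod_nat

/-- The contribution of the `n × n` matrices over `F₂` of corank `m` to the expected recovery
probability. -/
noncomputable def recoveryTerm (n m : ℕ) : ℝ :=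
  eulerPartial m (n - m) ^ 2 / (2 ^ (m * (m + 1)) * eulerPartial 0 (n - m))

lemma rankCount_two_mul (m r : ℕ) :
    rankCount 2 (2 ^ (m + r)) (m + r) r * (2 ^ r / 2 ^ (m + r)) / 2 ^ ((m + r) * (m + r)) =
      recoveryTerm (m + r) m := by
  have hD := prod_two_pow_sub 0 r
  rw [zero_add] at hD
  have hE : eulerPartial 0 r ≠ 0 := by linarith [quarter_le_eulerPartial r]
  rw [rankCount_eq_div, prod_two_pow_sub, hD, recoveryTerm, Nat.add_sub_cancel_left]
  field_simp
  ring

lemma expected_recovery_eq_sum (n : ℕ) :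
    (∑ M : Matrix (Fin n) (Fin n) (ZMod 2), (2 : ℝ) ^ M.rank / 2 ^ n) / 2 ^ (n * n) =
      ∑ m ∈ range (n + 1), recoveryTerm n m := by
  rw [sum_matrix_rank n n (fun r => (2 : ℝ) ^ r / 2 ^ n), sum_div, ← sum_range_reflect]
  refine sum_congr rfl fun m hm => ?_
  obtain ⟨r, rfl⟩ := Nat.exists_eq_add_of_le (Nat.lt_succ_iff.1 (mem_range.1 hm))
  rw [← rankCount_two_mul, show m + r + 1 - 1 - m = r by omega, ZMod.card, Nat.cast_ofNat]

lemma norm_recoveryTerm_le (n m : ℕ) : ‖recoveryTerm n m‖ ≤ 4 * (1 / 2) ^ m := by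
  have hq := quarter_le_eulerPartial (n - m)
  have h2 : (2 : ℝ) ^ m ≤ 2 ^ (m * (m + 1)) :=
    pow_le_pow_right₀ one_le_two (Nat.le_mul_of_pos_right m m.succ_pos)
  have h0 : (0 : ℝ) < 2 ^ m := by positivity
  rw [recoveryTerm, Real.norm_of_nonneg (by positivity)]
  calc _ ≤ 1 / ((2 : ℝ) ^ m * (1 / 4)) := by
        gcongr
        exact pow_le_one₀ (eulerPartial_nonneg _ _) (eulerPartial_le_one _ _)
    _ = 4 * (1 / 2) ^ m := by
        rw [one_div_pow]
        field_simp

lemma tendsto_recoveryTerm (m : ℕ) :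
    Tendsto (recoveryTerm · m) atTop
      (nhds ((∏' k : ℕ, (1 - ((2 : ℝ) ^ (m + (k + 1)))⁻¹) ^ 2) /
          (2 ^ (m * (m + 1)) * ∏' k : ℕ, (1 - ((2 : ℝ) ^ (k + 1))⁻¹)))) := by
  have h0 := tendsto_eulerPartial 0
  simp only [zero_add] at h0
  have hpos : (1 / 4 : ℝ) ≤ ∏' k : ℕ, (1 - ((2 : ℝ) ^ (k + 1))⁻¹) :=
    ge_of_tendsto' h0 quarter_le_eulerPartial
  have hs := tendsto_sub_atTop_nat m
  rw [(multipliable_one_sub_inv_two_pow m).tprod_pow]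
  exact (((tendsto_eulerPartial m).comp hs).pow 2).div ((h0.comp hs).const_mul _)
    (mul_ne_zero (by positivity) (by linarith))

end EulerPartial

/-- For a uniformly random `n × n` matrix `M_n` over `F₂ = ZMod 2`,
the expected recovery probability `𝔼[2^{rank M_n - n}]` converges, as `n → ∞`, to the
critical recovery rate
`r_c = Σ_{m=0}^∞ [∏_{k=1}^∞ (1 - 2^{-(m+k)})²] / [2^{m(m+1)} ∏_{k=1}^∞ (1 - 2^{-k})]`. -/
theorem critical_recovery_rate :
    Tendsto
      (fun n : ℕ =>
        (∑ M : Matrix (Fin n) (Fin n) (ZMod 2), (2 : ℝ) ^ M.rank / 2 ^ n) / 2 ^ (n * n))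
      atTop
      (nhds (∑' m : ℕ,
        (∏' k : ℕ, (1 - ((2 : ℝ) ^ (m + (k + 1)))⁻¹) ^ 2) /
          (2 ^ (m * (m + 1)) * ∏' k : ℕ, (1 - ((2 : ℝ) ^ (k + 1))⁻¹)))) := by
  have hsum (n : ℕ) : ∑' m, (if m ∈ Finset.range (n + 1) then recoveryTerm n m else 0) =
      ∑ m ∈ Finset.range (n + 1), recoveryTerm n m := by
    rw [tsum_eq_sum (s := Finset.range (n + 1)) fun m hm => if_neg hm]
    exact Finset.sum_congr rfl fun m hm => if_pos hm
  simp only [expected_recovery_eq_sum, ← hsum]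
  refine tendsto_tsum_of_dominated_convergence (summable_geometric_two.mul_left 4) (fun m => ?_)
    (Eventually.of_forall fun n m => ?_)
  · refine (tendsto_recoveryTerm m).congr' ?_
    filter_upwards [eventually_ge_atTop m] with n hn
    rw [if_pos (Finset.mem_range.2 (Nat.lt_succ_of_le hn))]
  · split_ifs
    · exact norm_recoveryTerm_le n m
    · rw [norm_zero]
      positivity
end

section
/- For every integer δ, the sequence of failure probabilities P_F(n) = 1 − 𝔼[2^{rank M_{n,n−δ} − n}], where M_{n,n−δ} is a uniformly random n × (n − δ) matrix over F₂ and n ranges over integers with n − δ ≥ 0, converges as n → ∞ to a limit f_∞(δ) ∈ [0, 1]. -/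
open Filter

theorem natCard_linearIndependent_cast {K V : Type*} [Field K] [Fintype K] [AddCommGroup V]
    [Module K V] [FiniteDimensional K V] (j : ℕ) :
    (Nat.card {s : Fin j → V // LinearIndependent K s} : ℝ) =
      ∏ i ∈ Finset.range j,
        ((Fintype.card K : ℝ) ^ Module.finrank K V - (Fintype.card K : ℝ) ^ i) := by
  have : Finite V := Module.finite_of_finite K
  have : Fintype V := Fintype.ofFinite V
  rcases le_or_gt j (Module.finrank K V) with h | h
  · rw [card_linearIndependent h, Nat.cast_prod, ← Fin.prod_univ_eq_prod_range
      (fun i ↦ (Fintype.card K : ℝ) ^ Module.finrank K V - (Fintype.card K : ℝ) ^ i)]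
    refine Finset.prod_congr rfl fun i _ ↦ ?_
    rw [Nat.cast_sub (Nat.pow_le_pow_right Fintype.card_pos (i.2.le.trans h))]
    push_cast
    rfl
  · rw [Finset.prod_eq_zero (Finset.mem_range.mpr h) (sub_self _)]
    have : IsEmpty {s : Fin j → V // LinearIndependent K s} :=
      ⟨fun s ↦ by simpa using s.2.fintype_card_le_finrank.trans_lt h⟩
    simp

theorem one_sub_mul_sum_newton (q y : ℝ) (hq : q ≠ 0) (J : ℕ) :
    1 - y * ∑ j ∈ Finset.range J, (-1) ^ j * (∏ i ∈ Finset.range j, (y - q ^ i)) /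
        ∏ i ∈ Finset.range (j + 1), q ^ i =
      ∏ i ∈ Finset.range J, (1 - y / q ^ i) := by
  have key (j : ℕ) : ∏ i ∈ Finset.range j, (1 - y / q ^ i) =
      (-1) ^ j * (∏ i ∈ Finset.range j, (y - q ^ i)) / ∏ i ∈ Finset.range j, q ^ i := by
    rw [show (-1 : ℝ) ^ j = ∏ _i ∈ Finset.range j, (-1 : ℝ) by simp,
      ← Finset.prod_mul_distrib, ← Finset.prod_div_distrib]
    refine Finset.prod_congr rfl fun i _ ↦ ?_
    field_simp
    ring
  induction J with
  | zero => simp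
  | succ J ih =>
    rw [Finset.sum_range_succ, mul_add, ← sub_sub, ih,
      Finset.prod_range_succ (fun i ↦ 1 - y / q ^ i), key, Finset.prod_range_succ (fun i ↦ q ^ i)]
    have : ∏ i ∈ Finset.range J, q ^ i ≠ 0 :=
      Finset.prod_ne_zero_iff.mpr fun i _ ↦ pow_ne_zero i hq
    field_simp

theorem inv_pow_eq_sum_newton (q : ℝ) (hq : q ≠ 0) {k n : ℕ} (hk : k ≤ n) :
    (q ^ k)⁻¹ = ∑ j ∈ Finset.range (n + 1),
      (-1) ^ j * (∏ i ∈ Finset.range j, (q ^ k - q ^ i)) / ∏ i ∈ Finset.range (j + 1), q ^ i := by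
  have h := one_sub_mul_sum_newton q (q ^ k) hq (n + 1)
  rw [Finset.prod_eq_zero (i := k) (Finset.mem_range.mpr (by omega))
    (by rw [div_self (pow_ne_zero k hq), sub_self]), sub_eq_zero] at h
  exact inv_eq_of_mul_eq_one_right h.symm

namespace Matrix

theorem finrank_ker_vecMulLinear {K m n : Type*} [Field K] [Fintype m] [Fintype n]
    (M : Matrix m n K) :
    Module.finrank K (LinearMap.ker M.vecMulLinear) = Fintype.card m - M.rank := by
  have h := LinearMap.finrank_range_add_finrank_ker M.vecMulLinear
  rw [← mulVecLin_transpose, ← Matrix.rank, rank_transpose, Module.finrank_fintype_fun_eq_card] at h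
  rw [← mulVecLin_transpose]
  omega

theorem natCard_mul_eq_zero {K l m n : Type*} [Field K] [Fintype K] [Fintype l]
    [Fintype m] [Fintype n] (S : Matrix l m K) (hS : LinearIndependent K S.row) :
    Nat.card {M : Matrix m n K // S * M = 0} =
      Fintype.card K ^ ((Fintype.card m - Fintype.card l) * Fintype.card n) := by
  let e : {M : Matrix m n K // S * M = 0} ≃ (n → LinearMap.ker S.mulVecLin) :=
    { toFun M c := ⟨fun i ↦ M.1 i c, by
        ext i
        exact congrFun (congrFun M.2 i) c⟩
      invFun f := ⟨of fun i c ↦ (f c).1 i, by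
        ext i c
        exact congrFun (f c).2 i⟩
      left_inv _ := rfl
      right_inv _ := rfl }
  have h := LinearMap.finrank_range_add_finrank_ker S.mulVecLin
  rw [← Matrix.rank, hS.rank_matrix, Module.finrank_fintype_fun_eq_card] at h
  rw [Nat.card_congr e, Nat.card_fun, Module.natCard_eq_pow_finrank (K := K), ← pow_mul,
    Nat.card_eq_fintype_card, Nat.card_eq_fintype_card, ← h, Nat.add_sub_cancel_left]

theorem natCard_linearIndependent_ker_vecMulLinear {K m n : Type*} [Field K]
    [Fintype m] (M : Matrix m n K) (j : ℕ) :
    Nat.card {s : Fin j → LinearMap.ker M.vecMulLinear // LinearIndependent K s} =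
      Nat.card {s : {s : Fin j → m → K // LinearIndependent K s} // of s.1 * M = 0} := by
  refine Nat.card_congr
    { toFun s := ⟨⟨fun i ↦ (s.1 i).1, s.2.map' _ (Submodule.ker_subtype _)⟩, ?_⟩
      invFun s := ⟨fun i ↦ ⟨s.1.1 i, ?_⟩, ?_⟩
      left_inv _ := rfl
      right_inv _ := rfl }
  · ext i c
    exact congrFun (s.1 i).2 c
  · ext c
    exact congrFun (congrFun s.2 i) c
  · exact LinearIndependent.of_comp (Submodule.subtype _) s.1.2

theorem sum_natCard_linearIndependent_ker_vecMulLinear {K : Type*} [Field K] [Fintype K]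
    (n m j : ℕ) :
    ∑ M : Matrix (Fin n) (Fin m) K,
        Nat.card {s : Fin j → LinearMap.ker M.vecMulLinear // LinearIndependent K s} =
      Nat.card {s : Fin j → Fin n → K // LinearIndependent K s} *
        Fintype.card K ^ ((n - j) * m) := by
  classical
  let X := {s : Fin j → Fin n → K // LinearIndependent K s}
  have : Fintype X := Fintype.ofFinite X
  have h := Finset.sum_card_bipartiteAbove_eq_sum_card_bipartiteBelow
    (s := (Finset.univ : Finset (Matrix (Fin n) (Fin m) K))) (t := (Finset.univ : Finset X))
    (fun (M : Matrix (Fin n) (Fin m) K) (s : X) ↦ of s.1 * M = 0)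
  simp only [natCard_linearIndependent_ker_vecMulLinear]
  calc _ = _ := Finset.sum_congr rfl fun M _ ↦ by
          rw [Nat.card_eq_fintype_card, Fintype.card_subtype, Finset.bipartiteAbove]
    _ = _ := h
    _ = ∑ s : X, Fintype.card K ^ ((n - j) * m) := Finset.sum_congr rfl fun s _ ↦ by
          have := natCard_mul_eq_zero (n := Fin m) (of s.1) s.2
          rw [Nat.card_eq_fintype_card, Fintype.card_subtype] at this
          simpa [Finset.bipartiteBelow] using this
    _ = _ := by simp [X, Nat.card_eq_fintype_card]

/-- The expectation of `q ^ (rank M - n)` for a uniformly random `n × m` matrix `M` over a field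
with `q` elements, as an alternating sum. -/
theorem sum_pow_rank_div {K : Type*} [Field K] [Fintype K] (n m : ℕ) :
    (∑ M : Matrix (Fin n) (Fin m) K, (Fintype.card K : ℝ) ^ M.rank / (Fintype.card K : ℝ) ^ n) /
        (Fintype.card K : ℝ) ^ (n * m) =
      ∑ j ∈ Finset.range (n + 1), (-1) ^ j *
        (∏ i ∈ Finset.range j, ((Fintype.card K : ℝ) ^ n - (Fintype.card K : ℝ) ^ i)) /
          (∏ i ∈ Finset.range (j + 1), (Fintype.card K : ℝ) ^ i) /
          (Fintype.card K : ℝ) ^ (j * m) := by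
  have hq : (Fintype.card K : ℝ) ≠ 0 := Nat.cast_ne_zero.mpr Fintype.card_ne_zero
  have hM (M : Matrix (Fin n) (Fin m) K) :
      (Fintype.card K : ℝ) ^ M.rank / (Fintype.card K : ℝ) ^ n =
        ∑ j ∈ Finset.range (n + 1), (-1) ^ j *
          (Nat.card {s : Fin j → LinearMap.ker M.vecMulLinear // LinearIndependent K s} : ℝ) /
          ∏ i ∈ Finset.range (j + 1), (Fintype.card K : ℝ) ^ i := by
    simp only [natCard_linearIndependent_cast, finrank_ker_vecMulLinear, Fintype.card_fin]
    rw [← inv_pow_eq_sum_newton _ hq (n.sub_le _), pow_sub₀ _ hq M.rank_le_height, mul_inv, inv_inv,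
      mul_comm, div_eq_mul_inv]
  simp only [hM]
  rw [Finset.sum_comm, Finset.sum_div]
  refine Finset.sum_congr rfl fun j hj ↦ ?_
  rw [← Finset.sum_div, ← Finset.mul_sum, ← Nat.cast_sum,
    sum_natCard_linearIndependent_ker_vecMulLinear, Nat.cast_mul, natCard_linearIndependent_cast,
    Module.finrank_fintype_fun_eq_card, Fintype.card_fin, Nat.cast_pow,
    show n * m = (n - j) * m + j * m by
      rw [← add_mul, Nat.sub_add_cancel (Finset.mem_range_succ_iff.mp hj)], pow_add]
  have : ∏ i ∈ Finset.range (j + 1), (Fintype.card K : ℝ) ^ i ≠ 0 :=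
    Finset.prod_ne_zero_iff.mpr fun i _ ↦ pow_ne_zero i hq
  field_simp

end Matrix

theorem summable_pow_div_prod_pow {q : ℝ} (hq : 1 < q) (c : ℝ) :
    Summable fun j : ℕ ↦ c ^ j / ∏ i ∈ Finset.range (j + 1), q ^ i := by
  rcases eq_or_ne c 0 with rfl | hc
  · exact summable_of_ne_finset_zero (s := {0}) fun j hj ↦ by simp_all
  have hq0 : 0 < q := one_pos.trans hq
  have hp (j : ℕ) : ∏ i ∈ Finset.range j, q ^ i ≠ 0 :=
    Finset.prod_ne_zero_iff.mpr fun i _ ↦ (pow_pos hq0 i).ne'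
  refine summable_of_ratio_test_tendsto_lt_one (l := 0) one_pos
    (.of_forall fun j ↦ div_ne_zero (pow_ne_zero j hc) (hp _)) ?_
  have h : Tendsto (fun j : ℕ ↦ |c| * (q⁻¹) ^ (j + 1)) atTop (nhds (|c| * 0)) :=
    ((tendsto_pow_atTop_nhds_zero_of_lt_one (inv_nonneg.mpr hq0.le)
      (inv_lt_one_of_one_lt₀ hq)).comp (tendsto_add_atTop_nat 1)).const_mul _
  rw [mul_zero] at h
  refine h.congr fun j ↦ ?_
  have := hp (j + 1)
  rw [← norm_div, Finset.prod_range_succ _ (j + 1), pow_succ c,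
    show c ^ j * c / ((∏ i ∈ Finset.range (j + 1), q ^ i) * q ^ (j + 1)) /
      (c ^ j / ∏ i ∈ Finset.range (j + 1), q ^ i) = c * (q⁻¹) ^ (j + 1) by
        rw [inv_pow]; field_simp,
    norm_mul, Real.norm_eq_abs, norm_pow, Real.norm_of_nonneg (inv_nonneg.mpr hq0.le)]

theorem tendsto_sum_newton {q : ℝ} (hq : 1 < q) (c : ℝ) :
    Tendsto
      (fun n : ℕ ↦ ∑ j ∈ Finset.range (n + 1),
        (-1) ^ j * (∏ i ∈ Finset.range j, (1 - q ^ i / q ^ n)) *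
          (c ^ j / ∏ i ∈ Finset.range (j + 1), q ^ i))
      atTop (nhds (∑' j : ℕ, (-1) ^ j * (c ^ j / ∏ i ∈ Finset.range (j + 1), q ^ i))) := by
  have hq0 : 0 < q := one_pos.trans hq
  have hvanish (n j : ℕ) (hj : n < j) : ∏ i ∈ Finset.range j, (1 - q ^ i / q ^ n) = 0 :=
    Finset.prod_eq_zero (Finset.mem_range.mpr hj) (by rw [div_self (pow_pos hq0 n).ne', sub_self])
  have hbound (n j : ℕ) : |∏ i ∈ Finset.range j, (1 - q ^ i / q ^ n)| ≤ 1 := by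
    rcases lt_or_ge n j with h | h
    · simp [hvanish n j h]
    · rw [Finset.abs_prod]
      refine Finset.prod_le_one (fun i _ ↦ abs_nonneg _) fun i hi ↦ ?_
      have h1 : q ^ i / q ^ n ≤ 1 := (div_le_one (pow_pos hq0 n)).mpr
        (pow_le_pow_right₀ hq.le ((Finset.mem_range.mp hi).le.trans h))
      have h0 : 0 ≤ q ^ i / q ^ n := by positivity
      rw [abs_le]
      constructor <;> linarith
  have hlim (j : ℕ) :
      Tendsto (fun n : ℕ ↦ ∏ i ∈ Finset.range j, (1 - q ^ i / q ^ n)) atTop (nhds 1) := by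
    have h := tendsto_finsetProd (Finset.range j) fun i _ ↦
      ((tendsto_pow_atTop_atTop_of_one_lt hq).const_div_atTop (q ^ i)).const_sub 1
    simpa using h
  have h := tendsto_tsum_of_dominated_convergence (𝓕 := atTop)
    (f := fun (n j : ℕ) ↦ (-1) ^ j * (∏ i ∈ Finset.range j, (1 - q ^ i / q ^ n)) *
      (c ^ j / ∏ i ∈ Finset.range (j + 1), q ^ i))
    (g := fun j : ℕ ↦ (-1) ^ j * (c ^ j / ∏ i ∈ Finset.range (j + 1), q ^ i))
    (summable_pow_div_prod_pow hq c).abs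
    (fun j ↦ by
      simpa using ((hlim j).const_mul ((-1) ^ j)).mul_const
        (c ^ j / ∏ i ∈ Finset.range (j + 1), q ^ i))
    (.of_forall fun n j ↦ by
      rw [norm_mul, norm_mul, norm_pow, norm_neg, norm_one, one_pow, one_mul]
      exact mul_le_of_le_one_left (norm_nonneg _) (hbound n j))
  refine h.congr fun n ↦ tsum_eq_sum fun j hj ↦ ?_
  rw [hvanish n j (by simpa [Nat.lt_succ_iff] using hj), mul_zero, zero_mul]

theorem Matrix.sum_pow_rank_div_mem_Icc {K : Type*} [Field K] [Fintype K]
    (n m : ℕ) :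
    (∑ M : Matrix (Fin n) (Fin m) K, (Fintype.card K : ℝ) ^ M.rank / (Fintype.card K : ℝ) ^ n) /
      (Fintype.card K : ℝ) ^ (n * m) ∈ Set.Icc (0 : ℝ) 1 := by
  have hq : (1 : ℝ) ≤ Fintype.card K := Nat.one_le_cast.mpr Fintype.card_pos
  refine ⟨by positivity, (div_le_one (by positivity)).mpr ?_⟩
  calc _ ≤ ∑ _M : Matrix (Fin n) (Fin m) K, (1 : ℝ) := Finset.sum_le_sum fun M _ ↦
          (div_le_one (by positivity)).mpr (pow_le_pow_right₀ hq M.rank_le_height)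
    _ = _ := by
      rw [Finset.sum_const, nsmul_one, Finset.card_univ, ← Nat.card_eq_fintype_card,
        Nat.card_congr of.symm]
      simp [← pow_mul, mul_comm m n]

/-- Over any finite field with `q` elements, the expectation of `q ^ (rank M - n)` for a uniformly
random `n × (n - δ)` matrix `M` converges as `n → ∞`. -/
theorem Matrix.tendsto_sum_pow_rank_div {K : Type*} [Field K] [Fintype K] (δ : ℤ) :
    Tendsto
      (fun n : ℕ ↦
        (∑ M : Matrix (Fin n) (Fin ((n : ℤ) - δ).toNat) K,
            (Fintype.card K : ℝ) ^ M.rank / (Fintype.card K : ℝ) ^ n) /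
          (Fintype.card K : ℝ) ^ (n * ((n : ℤ) - δ).toNat))
      atTop (nhds (∑' j : ℕ, (-1) ^ j * (((Fintype.card K : ℝ) ^ δ) ^ j /
        ∏ i ∈ Finset.range (j + 1), (Fintype.card K : ℝ) ^ i))) := by
  have hq : (1 : ℝ) < Fintype.card K := Nat.one_lt_cast.mpr Fintype.one_lt_card
  refine (tendsto_sum_newton hq _).congr' ?_
  filter_upwards [eventually_ge_atTop δ.toNat] with n hn
  rw [sum_pow_rank_div]
  refine Finset.sum_congr rfl fun j _ ↦ ?_
  set m := ((n : ℤ) - δ).toNat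
  set q : ℝ := (Fintype.card K : ℝ)
  have hq0 : q ≠ 0 := (one_pos.trans hq).ne'
  have hδ : q ^ δ = q ^ n / q ^ m := by
    rw [show δ = (n : ℤ) - m by omega, zpow_sub₀ hq0, zpow_natCast, zpow_natCast]
  have hprod : ∏ i ∈ Finset.range j, (q ^ n - q ^ i) =
      (q ^ n) ^ j * ∏ i ∈ Finset.range j, (1 - q ^ i / q ^ n) := by
    rw [show (q ^ n) ^ j = ∏ _i ∈ Finset.range j, q ^ n by simp, ← Finset.prod_mul_distrib]
    exact Finset.prod_congr rfl fun i _ ↦ by field_simp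
  rw [hprod, hδ, div_pow, mul_comm j m, pow_mul q m j]
  ring

/-- For every integer `δ`, the sequence of failure probabilities
`P_F(n) = 1 - 𝔼[2^{rank M_{n, n-δ} - n}]`, where `M_{n, n-δ}` is a uniformly random
`n × (n - δ)` matrix over `F₂ = ZMod 2` (and `n` ranges over integers with `n - δ ≥ 0`),
converges as `n → ∞` to a limit `f_∞(δ) ∈ [0, 1]`. -/
theorem failure_probability_limit_exists (δ : ℤ) :
    ∃ L ∈ Set.Icc (0 : ℝ) 1,
      Tendsto
        (fun n : ℕ =>
          1 - (∑ M : Matrix (Fin n) (Fin ((n : ℤ) - δ).toNat) (ZMod 2),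
                (2 : ℝ) ^ M.rank / 2 ^ n) /
              2 ^ (n * ((n : ℤ) - δ).toNat))
        atTop (nhds L) := by
  have h := Matrix.tendsto_sum_pow_rank_div (K := ZMod 2) δ
  have hmem (n : ℕ) := Matrix.sum_pow_rank_div_mem_Icc (K := ZMod 2) n ((n : ℤ) - δ).toNat
  simp only [ZMod.card, Nat.cast_ofNat] at h hmem
  have hL := isClosed_Icc.mem_of_tendsto h (.of_forall hmem)
  exact ⟨_, ⟨sub_nonneg.mpr hL.2, sub_le_self _ hL.1⟩, h.const_sub 1⟩
end

section
/- Let f_∞(δ) = lim_{n→∞} (1 − 𝔼[2^{rank M_{n,n−δ} − n}]) denote the limiting failure probability for uniformly random n × (n − δ) matrices over F₂. There exists a constant C > 0 such that for every integer δ ≤ 0 one has |f_∞(δ) − 2^{δ−1}| ≤ C·4^{δ}, and for every integer δ ≥ 0 one has |f_∞(δ) − (1 − 2^{−δ})| ≤ C·4^{−δ}. That is, far below threshold the failure probability is 2^{−|δ|−1} and far above threshold it is 1 − 2^{−|δ|}, with corrections exponentially suppressed as O(2^{−2|δ|}). -/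
open Filter

/-- A linear map on the standard space can be prescribed on a linearly independent family. -/
theorem exists_matrix_mulVec_eq {K ι m n : Type*} [Field K] [Fintype ι] [DecidableEq ι]
    [Fintype n] [DecidableEq n] {u : ι → n → K} (hu : LinearIndependent K u) (t : ι → m → K) :
    ∃ M : Matrix m n K, ∀ i, M.mulVec (u i) = t i := by
  obtain ⟨g, hg⟩ := LinearMap.exists_leftInverse_of_injective (Fintype.linearCombination K u)
    (LinearMap.ker_eq_bot.2 hu.fintypeLinearCombination_injective)
  refine ⟨LinearMap.toMatrix' (Fintype.linearCombination K t ∘ₗ g), fun i => ?_⟩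
  rw [LinearMap.toMatrix'_mulVec]
  have h : g (u i) = Pi.single i 1 := by
    have := LinearMap.congr_fun hg (Pi.single i 1)
    simpa [Fintype.linearCombination_apply_single] using this
  simp [h, Fintype.linearCombination_apply_single]

/-- The number of matrices over `F₂` whose kernel contains a given linearly independent family. -/
theorem card_matrix_mulVec_eq_zero {ι : Type*} [Fintype ι] [DecidableEq ι] {p q : ℕ}
    {u : ι → Fin q → ZMod 2} (hu : LinearIndependent (ZMod 2) u) :
    (Finset.univ.filter fun M : Matrix (Fin p) (Fin q) (ZMod 2) =>
      ∀ i, M.mulVec (u i) = 0).card * 2 ^ (p * Fintype.card ι) = 2 ^ (p * q) := by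
  let L : Matrix (Fin p) (Fin q) (ZMod 2) →ₗ[ZMod 2] (ι → Fin p → ZMod 2) :=
    LinearMap.pi fun i => (Matrix.mulVecBilin (ZMod 2) (ZMod 2)).flip (u i)
  have hL : Function.Surjective L := fun t => by
    obtain ⟨M, hM⟩ := exists_matrix_mulVec_eq hu t
    exact ⟨M, funext hM⟩
  have hr := L.finrank_range_add_finrank_ker
  rw [LinearMap.range_eq_top.2 hL, finrank_top, Module.finrank_pi_fintype] at hr
  simp only [Module.finrank_fin_fun, Module.finrank_matrix, Module.finrank_self, Fintype.card_fin,
    Finset.sum_const, Finset.card_univ, smul_eq_mul, mul_one] at hr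
  have hk : (Finset.univ.filter fun M : Matrix (Fin p) (Fin q) (ZMod 2) =>
      ∀ i, M.mulVec (u i) = 0).card = Nat.card (LinearMap.ker L) := by
    rw [← Fintype.card_subtype, ← Nat.card_eq_fintype_card]
    refine Nat.card_congr (Equiv.subtypeEquivRight fun M => ?_)
    simp [L, funext_iff, Matrix.mulVecBilin]
  rw [hk, Module.natCard_eq_pow_finrank (K := ZMod 2), Nat.card_zmod, ← pow_add]
  congr 1
  linarith [hr, mul_comm p (Fintype.card ι)]

/-- The kernel of a matrix over `F₂`, as a finite set. -/
def kerFinset {p q : ℕ} (M : Matrix (Fin p) (Fin q) (ZMod 2)) : Finset (Fin q → ZMod 2) :=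
  Finset.univ.filter fun v => M.mulVec v = 0

theorem card_kerFinset_mul_two_pow_rank {p q : ℕ} (M : Matrix (Fin p) (Fin q) (ZMod 2)) :
    (kerFinset M).card * 2 ^ M.rank = 2 ^ q := by
  have hk : (kerFinset M).card = Nat.card (LinearMap.ker M.mulVecLin) := by
    rw [kerFinset, ← Fintype.card_subtype, ← Nat.card_eq_fintype_card]
    exact Nat.card_congr (Equiv.subtypeEquivRight fun v => by simp)
  have hr := M.mulVecLin.finrank_range_add_finrank_ker
  rw [Module.finrank_fin_fun] at hr
  rw [hk, Module.natCard_eq_pow_finrank (K := ZMod 2), Nat.card_zmod, ← pow_add, Matrix.rank,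
    add_comm, hr]

theorem zero_mem_kerFinset {p q : ℕ} (M : Matrix (Fin p) (Fin q) (ZMod 2)) :
    0 ∈ kerFinset M := by
  simp [kerFinset]

theorem sum_card_kerFinset_sub_one (p q : ℕ) :
    (∑ M : Matrix (Fin p) (Fin q) (ZMod 2), ((kerFinset M).card - 1 : ℝ)) * 2 ^ p
      = 2 ^ (p * q) * (2 ^ q - 1) := by
  have h1 : ∀ M : Matrix (Fin p) (Fin q) (ZMod 2), ((kerFinset M).card - 1 : ℝ)
      = ∑ v ∈ Finset.univ.erase 0, if M.mulVec v = 0 then 1 else 0 := fun M => by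
    rw [← Nat.cast_pred (Finset.card_pos.2 ⟨0, zero_mem_kerFinset M⟩),
      ← Finset.card_erase_of_mem (zero_mem_kerFinset M), Finset.sum_boole]
    congr 2
    ext v
    simp [kerFinset]
  simp_rw [h1]
  rw [Finset.sum_comm, Finset.sum_mul]
  have h2 : ∀ v ∈ (Finset.univ : Finset (Fin q → ZMod 2)).erase 0,
      (∑ M : Matrix (Fin p) (Fin q) (ZMod 2), if M.mulVec v = 0 then (1 : ℝ) else 0) * 2 ^ p
        = 2 ^ (p * q) := fun v hv => by
    have := card_matrix_mulVec_eq_zero (p := p) (u := fun _ : Unit => v)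
      (LinearIndependent.of_subsingleton () (Finset.ne_of_mem_erase hv))
    simp only [forall_const, Fintype.card_unit, mul_one] at this
    rw [Finset.sum_boole]
    exact_mod_cast this
  rw [Finset.sum_congr rfl h2, Finset.sum_const, Finset.card_erase_of_mem (Finset.mem_univ _)]
  simp [ZMod.card, mul_comm]

theorem linearIndependent_pair_zmod_two {V : Type*} [AddCommGroup V] [Module (ZMod 2) V]
    {u v : V} (hu : u ≠ 0) (hv : v ≠ 0) (huv : u ≠ v) :
    LinearIndependent (ZMod 2) ![u, v] := by
  rw [LinearIndependent.pair_iff]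
  intro s t h
  have key : ∀ a : ZMod 2, a = 0 ∨ a = 1 := by decide
  rcases key s with rfl | rfl <;> rcases key t with rfl | rfl
  · simp
  · simp [hv] at h
  · simp [hu] at h
  · refine absurd ?_ huv
    rw [one_smul, one_smul] at h
    rw [← sub_eq_zero, sub_eq_add_neg, ZModModule.neg_eq_self, h]

theorem sum_card_kerFinset_factorial_moment_le (p q : ℕ) :
    (∑ M : Matrix (Fin p) (Fin q) (ZMod 2),
      ((kerFinset M).card - 1 : ℝ) * ((kerFinset M).card - 2)) * 4 ^ p
      ≤ 2 ^ (p * q) * 4 ^ q := by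
  have h1 : ∀ M : Matrix (Fin p) (Fin q) (ZMod 2),
      ((kerFinset M).card - 1 : ℝ) * ((kerFinset M).card - 2)
      = ∑ w ∈ ((Finset.univ : Finset (Fin q → ZMod 2)).erase 0).offDiag,
        if ∀ i, M.mulVec (![w.1, w.2] i) = 0 then 1 else 0 := fun M => by
    have hc : (((kerFinset M).erase 0).card : ℝ) = (kerFinset M).card - 1 := by
      rw [Finset.card_erase_of_mem (zero_mem_kerFinset M),
        Nat.cast_pred (Finset.card_pos.2 ⟨0, zero_mem_kerFinset M⟩)]
    have ho : ((((kerFinset M).erase 0).offDiag).card : ℝ)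
        = ((kerFinset M).card - 1 : ℝ) * ((kerFinset M).card - 2) := by
      rw [Finset.offDiag_card, Nat.cast_sub (Nat.le_mul_self _)]
      push_cast
      rw [hc]
      ring
    rw [← ho, Finset.sum_boole]
    congr 2
    ext w
    simp [kerFinset, Fin.forall_fin_two]
    tauto
  simp_rw [h1]
  rw [Finset.sum_comm, Finset.sum_mul]
  have h2 : ∀ w ∈ ((Finset.univ : Finset (Fin q → ZMod 2)).erase 0).offDiag,
      (∑ M : Matrix (Fin p) (Fin q) (ZMod 2),
        if ∀ i, M.mulVec (![w.1, w.2] i) = 0 then (1 : ℝ) else 0) * 4 ^ p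
        = 2 ^ (p * q) := fun w hw => by
    simp only [Finset.mem_offDiag, Finset.mem_erase, Finset.mem_univ, and_true] at hw
    have := card_matrix_mulVec_eq_zero (p := p)
      (linearIndependent_pair_zmod_two hw.1 hw.2.1 hw.2.2)
    rw [Fintype.card_fin, mul_comm p 2, pow_mul] at this
    norm_num only at this
    rw [Finset.sum_boole]
    exact_mod_cast this
  rw [Finset.sum_congr rfl h2, Finset.sum_const, nsmul_eq_mul, mul_comm]
  gcongr
  have : (((Finset.univ : Finset (Fin q → ZMod 2)).erase 0).offDiag).card ≤ 4 ^ q := by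
    refine (Finset.card_le_univ _).trans ?_
    simp [ZMod.card, ← mul_pow]
  exact_mod_cast this

/-- The average of `2 ^ (rank M - q)` over all `p × q` matrices over `F₂`. -/
noncomputable def avgTwoPowRank (p q : ℕ) : ℝ :=
  (∑ M : Matrix (Fin p) (Fin q) (ZMod 2), (2 : ℝ) ^ M.rank / 2 ^ q) / 2 ^ (p * q)

theorem two_pow_rank_div {p q : ℕ} (M : Matrix (Fin p) (Fin q) (ZMod 2)) :
    (2 : ℝ) ^ M.rank / 2 ^ q = ((kerFinset M).card : ℝ)⁻¹ := by
  have h : ((kerFinset M).card : ℝ) * 2 ^ M.rank = 2 ^ q := by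
    exact_mod_cast card_kerFinset_mul_two_pow_rank M
  have hp : (0 : ℝ) < (kerFinset M).card := by
    exact_mod_cast Finset.card_pos.2 ⟨0, zero_mem_kerFinset M⟩
  rw [← h]
  field_simp

theorem one_le_card_kerFinset {p q : ℕ} (M : Matrix (Fin p) (Fin q) (ZMod 2)) :
    (1 : ℝ) ≤ (kerFinset M).card := by
  exact_mod_cast Finset.card_pos.2 ⟨0, zero_mem_kerFinset M⟩

theorem sum_matrix_one (p q : ℕ) :
    ∑ _M : Matrix (Fin p) (Fin q) (ZMod 2), (1 : ℝ) = 2 ^ (p * q) := by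
  simp only [Finset.sum_const, Finset.card_univ, nsmul_eq_mul, mul_one]
  rw [← Nat.card_eq_fintype_card, Module.natCard_eq_pow_finrank (K := ZMod 2), Nat.card_zmod,
    Module.finrank_matrix]
  simp

theorem avgTwoPowRank_le_one (p q : ℕ) : avgTwoPowRank p q ≤ 1 := by
  rw [avgTwoPowRank, div_le_one (by positivity), ← sum_matrix_one p q]
  refine Finset.sum_le_sum fun M _ => ?_
  rw [two_pow_rank_div]
  exact inv_le_one_of_one_le₀ (one_le_card_kerFinset M)

theorem avg_card_kerFinset_sub_one (p q : ℕ) :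
    (∑ M : Matrix (Fin p) (Fin q) (ZMod 2), ((kerFinset M).card - 1 : ℝ)) / 2 ^ (p * q)
      = (2 ^ q - 1) / 2 ^ p := by
  rw [div_eq_div_iff (by positivity) (by positivity), sum_card_kerFinset_sub_one, mul_comm]

theorem one_sub_le_avgTwoPowRank (p q : ℕ) :
    1 - (2 ^ q - 1) / 2 ^ p ≤ avgTwoPowRank p q := by
  rw [← avg_card_kerFinset_sub_one, avgTwoPowRank, sub_le_iff_le_add, ← add_div,
    one_le_div (by positivity), ← Finset.sum_add_distrib, ← sum_matrix_one p q]
  refine Finset.sum_le_sum fun M _ => ?_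
  have h := one_le_card_kerFinset M
  rw [two_pow_rank_div, ← sub_nonneg]
  have : ((kerFinset M).card : ℝ)⁻¹ + ((kerFinset M).card - 1) - 1
      = ((kerFinset M).card - 1) ^ 2 / (kerFinset M).card := by
    field_simp
    ring
  rw [this]
  positivity

theorem abs_avgTwoPowRank_sub_le (p q : ℕ) :
    |avgTwoPowRank p q - (1 - (2 ^ q - 1) / 2 ^ p / 2)| ≤ 4 ^ q / 4 ^ p / 2 := by
  have hterm : ∀ M : Matrix (Fin p) (Fin q) (ZMod 2), (2 : ℝ) ^ M.rank / 2 ^ q =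
      1 - ((kerFinset M).card - 1) / 2
        + (((kerFinset M).card - 1) * ((kerFinset M).card - 2)) / (2 * (kerFinset M).card) := by
    intro M
    have h := one_le_card_kerFinset M
    rw [two_pow_rank_div]
    field_simp
    ring
  have hnn : ∀ M : Matrix (Fin p) (Fin q) (ZMod 2),
      0 ≤ ((kerFinset M).card - 1 : ℝ) * ((kerFinset M).card - 2) := by
    intro M
    rcases (Nat.succ_le_of_lt (Finset.card_pos.2 ⟨0, zero_mem_kerFinset M⟩)).eq_or_lt with h | h
    · simp [← h]
    · have h2 : (2 : ℝ) ≤ (kerFinset M).card := by exact_mod_cast h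
      exact mul_nonneg (by linarith) (by linarith)
  have heq : avgTwoPowRank p q - (1 - (2 ^ q - 1) / 2 ^ p / 2) =
      (∑ M : Matrix (Fin p) (Fin q) (ZMod 2),
        (((kerFinset M).card - 1 : ℝ) * ((kerFinset M).card - 2)) / (2 * (kerFinset M).card))
        / 2 ^ (p * q) := by
    rw [avgTwoPowRank, Finset.sum_congr rfl fun M _ => hterm M, Finset.sum_add_distrib,
      Finset.sum_sub_distrib, sum_matrix_one, ← avg_card_kerFinset_sub_one, ← Finset.sum_div]
    field_simp
    ring
  have hle : (∑ M : Matrix (Fin p) (Fin q) (ZMod 2),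
        (((kerFinset M).card - 1 : ℝ) * ((kerFinset M).card - 2)) / (2 * (kerFinset M).card)) ≤
      (∑ M : Matrix (Fin p) (Fin q) (ZMod 2),
        (((kerFinset M).card - 1 : ℝ) * ((kerFinset M).card - 2))) / 2 := by
    rw [Finset.sum_div]
    refine Finset.sum_le_sum fun M _ => ?_
    have h := one_le_card_kerFinset M
    exact div_le_div_of_nonneg_left (hnn M) two_pos (by linarith)
  have hmom := sum_card_kerFinset_factorial_moment_le p q
  rw [heq, abs_of_nonneg (div_nonneg (Finset.sum_nonneg fun M _ => div_nonneg (hnn M)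
    (by positivity)) (by positivity)), div_le_iff₀ (by positivity)]
  refine hle.trans ?_
  rw [← le_div_iff₀ (by positivity)] at hmom
  calc _ ≤ (2 : ℝ) ^ (p * q) * 4 ^ q / 4 ^ p / 2 := by gcongr
    _ = _ := by ring

theorem sum_two_pow_rank_transpose (p q : ℕ) :
    ∑ M : Matrix (Fin p) (Fin q) (ZMod 2), (2 : ℝ) ^ M.rank / 2 ^ p
      = ∑ M : Matrix (Fin q) (Fin p) (ZMod 2), (2 : ℝ) ^ M.rank / 2 ^ p :=
  Fintype.sum_equiv (Matrix.transposeAddEquiv _ _ _).toEquiv _ _ fun M => by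
    simp [Matrix.rank_transpose]

/-- Let `f_∞ δ` be the limiting failure probability
`lim_{n→∞} (1 - 𝔼[2^{rank M_{n,n-δ} - n}])` for uniformly random `n × (n - δ)` matrices
over `F₂ = ZMod 2`.  Then there is a constant `C > 0` such that for every `δ ≤ 0`,
`|f_∞ δ - 2^{δ-1}| ≤ C·4^δ`, and for every `δ ≥ 0`, `|f_∞ δ - (1 - 2^{-δ})| ≤ C·4^{-δ}`:
far below threshold the failure probability is `2^{-|δ|-1}`, far above it is
`1 - 2^{-|δ|}`, with corrections exponentially suppressed as `O(2^{-2|δ|})`. -/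
theorem failure_probability_asymptotics (f : ℤ → ℝ)
    (hf : ∀ δ : ℤ,
      Tendsto
        (fun n : ℕ =>
          1 - (∑ M : Matrix (Fin n) (Fin ((n : ℤ) - δ).toNat) (ZMod 2),
                (2 : ℝ) ^ M.rank / 2 ^ n) /
              2 ^ (n * ((n : ℤ) - δ).toNat))
        atTop (nhds (f δ))) :
    ∃ C > 0,
      (∀ δ : ℤ, δ ≤ 0 → |f δ - (2 : ℝ) ^ (δ - 1)| ≤ C * (4 : ℝ) ^ δ) ∧
      (∀ δ : ℤ, 0 ≤ δ → |f δ - (1 - (2 : ℝ) ^ (-δ))| ≤ C * (4 : ℝ) ^ (-δ)) := by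
  refine ⟨1, one_pos, fun δ hδ => ?_, fun δ hδ => ?_⟩
  · obtain ⟨d, rfl⟩ : ∃ d : ℕ, δ = -d := ⟨δ.natAbs, by omega⟩
    refine le_of_tendsto ((hf (-d)).sub_const _).abs (eventually_atTop.2 ⟨d, fun n hn => ?_⟩)
    have hm : ((n : ℤ) - -d).toNat = n + d := by omega
    rw [hm, sum_two_pow_rank_transpose, mul_comm n (n + d)]
    have h := abs_avgTwoPowRank_sub_le (n + d) n
    rw [avgTwoPowRank] at h
    have h4 : (4 : ℝ) ^ n / 4 ^ (n + d) = (4 ^ d)⁻¹ := by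
      rw [pow_add]
      field_simp
    have h2 : ((2 : ℝ) ^ n - 1) / 2 ^ (n + d) = (2 ^ d)⁻¹ - (2 ^ (n + d))⁻¹ := by
      rw [pow_add]
      field_simp
    have h3 : ((2 : ℝ) ^ (n + d))⁻¹ ≤ (4 ^ d)⁻¹ := by
      have : (4 : ℝ) ^ d = 2 ^ (d + d) := by rw [pow_add, ← mul_pow]; norm_num
      rw [this]
      gcongr
      norm_num
    have h5 : (0 : ℝ) < (2 ^ (n + d))⁻¹ := by positivity
    rw [zpow_sub₀ two_ne_zero, zpow_neg, zpow_neg, zpow_natCast, zpow_natCast, zpow_one, one_mul]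
    rw [h4, h2] at h
    rw [abs_le] at h ⊢
    constructor <;> linarith [h.1, h.2]
  · obtain ⟨d, rfl⟩ : ∃ d : ℕ, δ = d := ⟨δ.natAbs, by omega⟩
    refine le_of_tendsto ((hf d).sub_const _).abs (eventually_atTop.2 ⟨d, fun n hn => ?_⟩)
    obtain ⟨m, rfl⟩ := Nat.exists_eq_add_of_le' hn
    have hm : (((m + d : ℕ) : ℤ) - d).toNat = m := by omega
    rw [hm]
    have hA : (∑ M : Matrix (Fin (m + d)) (Fin m) (ZMod 2), (2 : ℝ) ^ M.rank / 2 ^ (m + d)) /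
        2 ^ ((m + d) * m) = (2 ^ d)⁻¹ * avgTwoPowRank (m + d) m := by
      rw [avgTwoPowRank, ← mul_div_assoc, Finset.mul_sum]
      congr 1
      refine Finset.sum_congr rfl fun M _ => ?_
      rw [pow_add]
      field_simp
    have hu := avgTwoPowRank_le_one (m + d) m
    have hl := one_sub_le_avgTwoPowRank (m + d) m
    have h2 : ((2 : ℝ) ^ m - 1) / 2 ^ (m + d) ≤ (2 ^ d)⁻¹ := by
      rw [pow_add, div_le_iff₀ (by positivity)]
      field_simp
      linarith
    have h4 : ((4 : ℝ) ^ d)⁻¹ = (2 ^ d)⁻¹ * (2 ^ d)⁻¹ := by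
      rw [← mul_inv, ← mul_pow]
      norm_num
    have h5 : (0 : ℝ) < (2 ^ d)⁻¹ := by positivity
    rw [hA, zpow_neg, zpow_neg, zpow_natCast, zpow_natCast, one_mul, h4]
    rw [abs_le]
    constructor <;> nlinarith
end

section
/- (Fourth moment of Haar-random unitaries / two-design identity.) Let d ≥ 2, let μ be the Haar probability measure on the unitary group U(d) of d × d complex unitary matrices, and fix indices a, a', b, b', c, c', e, e' ∈ Fin d. Then ∫ U_{a'a} · conj(U_{b'b}) · U_{c'c} · conj(U_{e'e}) dμ(U) = (1/(d² − 1)) · [ δ_{a'b'} δ_{c'e'} δ_{ab} δ_{ce} + δ_{a'e'} δ_{b'c'} δ_{ae} δ_{bc} − (1/d)(δ_{ab} δ_{ce} δ_{a'e'} δ_{b'c'} + δ_{a'b'} δ_{c'e'} δ_{ae} δ_{bc}) ]. -/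
open MeasureTheory Matrix

section HaarUnitary

variable {d : ℕ}

/-- The monomial `U_{ia} conj(U_{jb}) U_{kc} conj(U_{le})` in the entries of a unitary matrix. -/
def unitaryMonomial (a b c e i j k l : Fin d) (U : Matrix.unitaryGroup (Fin d) ℂ) : ℂ :=
  (U : Matrix (Fin d) (Fin d) ℂ) i a * (starRingEnd ℂ) ((U : Matrix (Fin d) (Fin d) ℂ) j b) *
    (U : Matrix (Fin d) (Fin d) ℂ) k c * (starRingEnd ℂ) ((U : Matrix (Fin d) (Fin d) ℂ) l e)

theorem sum_mul_conj_unitary (U : Matrix.unitaryGroup (Fin d) ℂ) (a b : Fin d) :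
    ∑ i, (U : Matrix (Fin d) (Fin d) ℂ) i a *
      (starRingEnd ℂ) ((U : Matrix (Fin d) (Fin d) ℂ) i b) = if a = b then 1 else 0 := by
  have h := congrFun (congrFun (Matrix.mem_unitaryGroup_iff'.mp U.2) b) a
  simp only [Matrix.mul_apply, Matrix.star_apply, Matrix.one_apply] at h
  simp only [eq_comm (a := a), ← h]
  exact Finset.sum_congr rfl fun i _ => mul_comm _ _

theorem continuous_unitaryMonomial (a b c e i j k l : Fin d) :
    Continuous (unitaryMonomial a b c e i j k l) := by
  have h : ∀ i a : Fin d, Continuous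
      fun U : Matrix.unitaryGroup (Fin d) ℂ => (U : Matrix (Fin d) (Fin d) ℂ) i a :=
    fun i a => continuous_subtype_val.matrix_elem i a
  unfold unitaryMonomial
  exact (((h i a).mul (Complex.continuous_conj.comp (h j b))).mul (h k c)).mul
    (Complex.continuous_conj.comp (h l e))

theorem norm_unitaryMonomial_le_one (a b c e i j k l : Fin d)
    (U : Matrix.unitaryGroup (Fin d) ℂ) : ‖unitaryMonomial a b c e i j k l U‖ ≤ 1 := by
  have h := fun i a : Fin d => entry_norm_bound_of_unitary U.2 i a
  simp only [unitaryMonomial, norm_mul, RCLike.norm_conj]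
  exact mul_le_one₀ (mul_le_one₀ (mul_le_one₀ (h i a) (norm_nonneg _) (h j b))
    (norm_nonneg _) (h k c)) (norm_nonneg _) (h l e)

variable [MeasurableSpace (Matrix.unitaryGroup (Fin d) ℂ)]
  (μ : Measure (Matrix.unitaryGroup (Fin d) ℂ))

/-- The fourth moment tensor of `μ`, with fixed column indices `a b c e`. -/
noncomputable def unitaryMoment (a b c e i j k l : Fin d) : ℂ :=
  ∫ U, unitaryMonomial a b c e i j k l U ∂μ

theorem unitaryMoment_swap (a b c e i j k l : Fin d) :
    unitaryMoment μ a b c e i j k l = unitaryMoment μ a e c b i l k j := by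
  unfold unitaryMoment unitaryMonomial
  congr 1
  ext U
  ring

variable [BorelSpace (Matrix.unitaryGroup (Fin d) ℂ)]

theorem integrable_unitaryMonomial [IsFiniteMeasure μ] (a b c e i j k l : Fin d) :
    Integrable (unitaryMonomial a b c e i j k l) μ :=
  Integrable.of_bound (continuous_unitaryMonomial a b c e i j k l).aestronglyMeasurable 1
    (Filter.Eventually.of_forall (norm_unitaryMonomial_le_one a b c e i j k l))

theorem sum_unitaryMoment_adjacent [IsProbabilityMeasure μ] (a b c e : Fin d) :
    ∑ i, ∑ k, unitaryMoment μ a b c e i i k k =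
      (if a = b then 1 else 0) * (if c = e then 1 else 0) := by
  simp only [unitaryMoment]
  simp only [← integral_finsetSum Finset.univ
    fun _ _ => integrable_unitaryMonomial μ _ _ _ _ _ _ _ _]
  rw [← integral_finsetSum Finset.univ fun _ _ => integrable_finsetSum _
    fun _ _ => integrable_unitaryMonomial μ _ _ _ _ _ _ _ _]
  have h : ∀ U : Matrix.unitaryGroup (Fin d) ℂ,
      ∑ i, ∑ k, unitaryMonomial a b c e i i k k U =
        (if a = b then 1 else 0) * (if c = e then 1 else 0) := fun U => by
    rw [← sum_mul_conj_unitary U a b, ← sum_mul_conj_unitary U c e, Finset.sum_mul_sum]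
    simp only [unitaryMonomial, mul_assoc]
  simp only [h, integral_const, probReal_univ, one_smul]

theorem sum_unitaryMoment_crossed [IsProbabilityMeasure μ] (a b c e : Fin d) :
    ∑ i, ∑ k, unitaryMoment μ a b c e i k k i =
      (if a = e then 1 else 0) * (if b = c then 1 else 0) := by
  simp only [unitaryMoment_swap μ a b c e, sum_unitaryMoment_adjacent, eq_comm (a := c)]

variable [μ.IsMulLeftInvariant]

theorem unitaryMoment_eq_integral_mul (V : Matrix.unitaryGroup (Fin d) ℂ)
    (a b c e i j k l : Fin d) :
    unitaryMoment μ a b c e i j k l = ∫ U, unitaryMonomial a b c e i j k l (V * U) ∂μ :=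
  (integral_mul_left_eq_self (unitaryMonomial a b c e i j k l) V).symm

theorem unitaryMoment_eq_sum [IsFiniteMeasure μ] (V : Matrix.unitaryGroup (Fin d) ℂ)
    (a b c e i j k l : Fin d) :
    unitaryMoment μ a b c e i j k l = ∑ l', ∑ k', ∑ j', ∑ i',
      (V : Matrix (Fin d) (Fin d) ℂ) i i' *
        (starRingEnd ℂ) ((V : Matrix (Fin d) (Fin d) ℂ) j j') *
        (V : Matrix (Fin d) (Fin d) ℂ) k k' *
        (starRingEnd ℂ) ((V : Matrix (Fin d) (Fin d) ℂ) l l') *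
        unitaryMoment μ a b c e i' j' k' l' := by
  have hI := fun i j k l => integrable_unitaryMonomial μ a b c e i j k l
  have h : ∀ U, unitaryMonomial a b c e i j k l (V * U) = ∑ l', ∑ k', ∑ j', ∑ i',
      (V : Matrix (Fin d) (Fin d) ℂ) i i' *
        (starRingEnd ℂ) ((V : Matrix (Fin d) (Fin d) ℂ) j j') *
        (V : Matrix (Fin d) (Fin d) ℂ) k k' *
        (starRingEnd ℂ) ((V : Matrix (Fin d) (Fin d) ℂ) l l') *
        unitaryMonomial a b c e i' j' k' l' U := fun U => by
    simp only [unitaryMonomial, Matrix.UnitaryGroup.mul_val, Matrix.mul_apply, map_sum, map_mul,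
      Finset.sum_mul, Finset.mul_sum]
    refine Finset.sum_congr rfl fun _ _ => Finset.sum_congr rfl fun _ _ =>
      Finset.sum_congr rfl fun _ _ => Finset.sum_congr rfl fun _ _ => ?_
    ring
  rw [unitaryMoment_eq_integral_mul μ V]
  simp only [h]
  rw [integral_finsetSum _ fun _ _ => by fun_prop]
  refine Finset.sum_congr rfl fun _ _ => ?_
  rw [integral_finsetSum _ fun _ _ => by fun_prop]
  refine Finset.sum_congr rfl fun _ _ => ?_
  rw [integral_finsetSum _ fun _ _ => by fun_prop]
  refine Finset.sum_congr rfl fun _ _ => ?_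
  rw [integral_finsetSum _ fun _ _ => by fun_prop]
  refine Finset.sum_congr rfl fun _ _ => ?_
  rw [integral_const_mul, unitaryMoment]

theorem unitaryMoment_diagonal (z : Fin d → ℂ) (hz : ∀ i, z i * (starRingEnd ℂ) (z i) = 1)
    (a b c e i j k l : Fin d) :
    unitaryMoment μ a b c e i j k l =
      z i * (starRingEnd ℂ) (z j) * z k * (starRingEnd ℂ) (z l) *
        unitaryMoment μ a b c e i j k l := by
  have hV : Matrix.diagonal z ∈ Matrix.unitaryGroup (Fin d) ℂ := by
    rw [Matrix.mem_unitaryGroup_iff, Matrix.star_eq_conjTranspose,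
      Matrix.diagonal_conjTranspose, Matrix.diagonal_mul_diagonal, ← Matrix.diagonal_one]
    exact congrArg _ (funext hz)
  conv_lhs => rw [unitaryMoment_eq_integral_mul μ ⟨_, hV⟩]
  rw [unitaryMoment, ← integral_const_mul]
  congr 1
  ext U
  simp only [unitaryMonomial, Matrix.UnitaryGroup.mul_val, Matrix.diagonal_mul, map_mul]
  ring

theorem unitaryMoment_perm (σ : Equiv.Perm (Fin d)) (a b c e i j k l : Fin d) :
    unitaryMoment μ a b c e i j k l = unitaryMoment μ a b c e (σ i) (σ j) (σ k) (σ l) := by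
  have hV : σ.permMatrix ℂ ∈ Matrix.unitaryGroup (Fin d) ℂ := by
    rw [Matrix.mem_unitaryGroup_iff, Matrix.star_eq_conjTranspose,
      Matrix.conjTranspose_permMatrix, ← Matrix.permMatrix_mul]
    simp
  rw [unitaryMoment_eq_integral_mul μ ⟨_, hV⟩, unitaryMoment]
  congr 1
  ext U
  simp only [unitaryMonomial, Matrix.UnitaryGroup.mul_val, PEquiv.toMatrix_toPEquiv_mul,
    Equiv.Perm.permMatrix, Matrix.submatrix_apply, id_eq]

theorem unitaryMoment_eq_zero {a b c e i j k l : Fin d} (h₁ : ¬(i = j ∧ k = l))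
    (h₂ : ¬(i = l ∧ j = k)) : unitaryMoment μ a b c e i j k l = 0 := by
  by_contra hT
  have key : ∀ p : Fin d,
      (if i = p then Complex.I else 1) * (starRingEnd ℂ) (if j = p then Complex.I else 1) *
        (if k = p then Complex.I else 1) * (starRingEnd ℂ) (if l = p then Complex.I else 1) =
        1 := fun p =>
    (right_eq_mul₀ hT).mp <| unitaryMoment_diagonal μ (fun m => if m = p then Complex.I else 1)
      (fun m => by split_ifs <;> simp) a b c e i j k l
  have hi := key i
  have hk := key k
  clear key hT
  split_ifs at hi hk <;> simp [Complex.ext_iff] at hi hk <;> grind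

theorem unitaryMoment_const [IsFiniteMeasure μ] (a b c e : Fin d) {p q : Fin d} (hpq : p ≠ q) :
    unitaryMoment μ a b c e p p p p =
      unitaryMoment μ a b c e p p q q + unitaryMoment μ a b c e p q q p := by
  set v : Fin d → ℂ := Pi.single p 1 + Pi.single q (-2) with hv
  have hvv : v ⬝ᵥ v = 5 := by
    simp [hv, hpq, hpq.symm]
    norm_num
  have hV : (1 - (2 / 5 : ℂ) • vecMulVec v v) ∈ Matrix.unitaryGroup (Fin d) ℂ := by
    have hstar : star v = v := by
      ext m
      simp only [hv, Pi.star_apply, Pi.add_apply, Pi.single_apply]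
      split_ifs <;> simp
    rw [Matrix.mem_unitaryGroup_iff, Matrix.star_eq_conjTranspose]
    simp only [conjTranspose_sub, conjTranspose_one, conjTranspose_smul, conjTranspose_vecMulVec,
      hstar, mul_sub, sub_mul, vecMulVec_mul_vecMulVec, smul_mul_assoc, mul_smul_comm, hvv,
      mul_one, one_mul]
    ext m n
    simp [vecMulVec_apply]
    ring
  have hrow : ∀ m, (1 - (2 / 5 : ℂ) • vecMulVec v v) p m =
      (if m = p then 3 / 5 else 0) + (if m = q then 4 / 5 else 0) := fun m => by
    by_cases hp : m = p
    · subst hp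
      simp [hv, vecMulVec_apply, hpq]
      norm_num
    · by_cases hq : m = q
      · subst hq
        simp [hv, vecMulVec_apply, hpq, hpq.symm]
        norm_num
      · simp [hv, vecMulVec_apply, hpq, hp, hq, Ne.symm hp]
  have h := unitaryMoment_eq_sum μ ⟨_, hV⟩ a b c e p p p p
  simp only [hrow, map_add, apply_ite (starRingEnd ℂ), map_zero, map_div₀, map_ofNat, mul_add,
    add_mul, Finset.sum_add_distrib, ite_mul, mul_ite, zero_mul, mul_zero, Finset.sum_ite_eq',
    Finset.mem_univ, if_true, Finset.sum_ite_irrel, Finset.sum_const_zero] at h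
  have hswap := unitaryMoment_perm μ (Equiv.swap p q) a b c e
  have h₁ := hswap p p p p
  have h₂ := hswap p p q q
  have h₃ := hswap p q q p
  simp only [Equiv.swap_apply_left, Equiv.swap_apply_right] at h₁ h₂ h₃
  simp [unitaryMoment_eq_zero, hpq, hpq.symm, ← h₁, ← h₂, ← h₃] at h
  linear_combination (625 / 288) * h

theorem unitaryMoment_pair_eq (a b c e : Fin d) {p q r s : Fin d} (hpq : p ≠ q) (hrs : r ≠ s) :
    unitaryMoment μ a b c e p p q q = unitaryMoment μ a b c e r r s s ∧
      unitaryMoment μ a b c e p q q p = unitaryMoment μ a b c e r s s r := by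
  set σ : Equiv.Perm (Fin d) := (Equiv.swap p r).trans (Equiv.swap (Equiv.swap p r q) s) with hσ
  have hq : σ q = s := by simp [hσ]
  have hp : σ p = r := by
    have h : r ≠ Equiv.swap p r q := fun h => hpq <| (Equiv.swap p r).injective (by simpa using h)
    simp [hσ, Equiv.swap_apply_of_ne_of_ne h hrs]
  have h := unitaryMoment_perm μ σ a b c e
  exact ⟨by rw [h, hp, hq], by rw [h, hp, hq]⟩

theorem exists_unitaryMoment_eq [IsFiniteMeasure μ] (hd : 2 ≤ d) (a b c e : Fin d) :
    ∃ α β : ℂ, ∀ i j k l, unitaryMoment μ a b c e i j k l =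
      α * ((if i = j then 1 else 0) * (if k = l then 1 else 0)) +
        β * ((if i = l then 1 else 0) * (if j = k then 1 else 0)) := by
  obtain ⟨p, q, hpq⟩ : ∃ p q : Fin d, p ≠ q := ⟨⟨0, by omega⟩, ⟨1, by omega⟩, by simp⟩
  refine ⟨unitaryMoment μ a b c e p p q q, unitaryMoment μ a b c e p q q p, fun i j k l => ?_⟩
  by_cases h₁ : i = j ∧ k = l
  · obtain ⟨rfl, rfl⟩ := h₁
    by_cases hik : i = k
    · subst hik
      have : ∃ s, i ≠ s := by
        by_cases hip : i = p
        · exact ⟨q, hip ▸ hpq⟩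
        · exact ⟨p, hip⟩
      obtain ⟨s, hs⟩ := this
      rw [unitaryMoment_const μ a b c e hs, (unitaryMoment_pair_eq μ a b c e hpq hs).1,
        (unitaryMoment_pair_eq μ a b c e hpq hs).2]
      simp
    · simp [hik, (unitaryMoment_pair_eq μ a b c e hpq hik).1]
  · by_cases h₂ : i = l ∧ j = k
    · obtain ⟨rfl, rfl⟩ := h₂
      have hij : i ≠ j := fun h => h₁ ⟨h, h.symm⟩
      simp [hij, (unitaryMoment_pair_eq μ a b c e hpq hij).2]
    · rw [unitaryMoment_eq_zero μ h₁ h₂]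
      simp only [← ite_and, mul_ite, mul_one, mul_zero, and_comm (a := k = l),
        and_comm (a := j = k), h₁, h₂, if_false, add_zero]

end HaarUnitary


/-- Fourth moment of Haar-random unitaries / two-design identity:
for `d ≥ 2`, the Haar probability measure `μ` on the unitary group `U(d)`, and indices
`a a' b b' c c' e e'`, one has
`∫ U_{a'a} conj(U_{b'b}) U_{c'c} conj(U_{e'e}) dμ(U)
  = (1/(d²-1)) [δ_{a'b'} δ_{c'e'} δ_{ab} δ_{ce} + δ_{a'e'} δ_{b'c'} δ_{ae} δ_{bc}
      - (1/d)(δ_{ab} δ_{ce} δ_{a'e'} δ_{b'c'} + δ_{a'b'} δ_{c'e'} δ_{ae} δ_{bc})]`. -/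
theorem haar_unitary_fourth_moment (d : ℕ) (hd : 2 ≤ d)
    [MeasurableSpace (Matrix.unitaryGroup (Fin d) ℂ)]
    [BorelSpace (Matrix.unitaryGroup (Fin d) ℂ)]
    (μ : Measure (Matrix.unitaryGroup (Fin d) ℂ))
    [μ.IsHaarMeasure] [IsProbabilityMeasure μ]
    (a a' b b' c c' e e' : Fin d) :
    ∫ U : Matrix.unitaryGroup (Fin d) ℂ,
        (U : Matrix (Fin d) (Fin d) ℂ) a' a *
          (starRingEnd ℂ) ((U : Matrix (Fin d) (Fin d) ℂ) b' b) *
          (U : Matrix (Fin d) (Fin d) ℂ) c' c *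
          (starRingEnd ℂ) ((U : Matrix (Fin d) (Fin d) ℂ) e' e) ∂μ =
      (1 / ((d : ℂ) ^ 2 - 1)) *
        ((if a' = b' then 1 else 0) * (if c' = e' then 1 else 0) *
            (if a = b then 1 else 0) * (if c = e then 1 else 0) +
          (if a' = e' then 1 else 0) * (if b' = c' then 1 else 0) *
            (if a = e then 1 else 0) * (if b = c then 1 else 0) -
          (1 / (d : ℂ)) *
            ((if a = b then 1 else 0) * (if c = e then 1 else 0) *
                (if a' = e' then 1 else 0) * (if b' = c' then 1 else 0) +
              (if a' = b' then 1 else 0) * (if c' = e' then 1 else 0) *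
                (if a = e then 1 else 0) * (if b = c then 1 else 0))) := by
  change unitaryMoment μ a b c e a' b' c' e' = _
  obtain ⟨α, β, h⟩ := exists_unitaryMoment_eq μ hd a b c e
  have hcomm : ∀ i k : Fin d, (k = i ∧ i = k) = (i = k) := by grind
  have hadj : (d : ℂ) ^ 2 * α + d * β =
      (if a = b then 1 else 0) * (if c = e then 1 else 0) := by
    rw [← sum_unitaryMoment_adjacent μ a b c e]
    simp [h, ← ite_and, Finset.sum_add_distrib]
    ring
  have hcross : d * α + (d : ℂ) ^ 2 * β =
      (if a = e then 1 else 0) * (if b = c then 1 else 0) := by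
    rw [← sum_unitaryMoment_crossed μ a b c e]
    simp [h, ← ite_and, hcomm, Finset.sum_add_distrib]
    ring
  have hd₀ : (d : ℂ) ≠ 0 := by exact_mod_cast (by omega : d ≠ 0)
  have hd₁ : (d : ℂ) ^ 2 - 1 ≠ 0 := by
    rw [sub_ne_zero]
    have : d ^ 2 ≠ 1 := by nlinarith
    exact_mod_cast this
  have hα : α = 1 / ((d : ℂ) ^ 2 - 1) * ((if a = b then 1 else 0) * (if c = e then 1 else 0) -
      1 / d * ((if a = e then 1 else 0) * (if b = c then 1 else 0))) := by
    rw [← hadj, ← hcross]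
    field_simp
    ring
  have hβ : β = 1 / ((d : ℂ) ^ 2 - 1) * ((if a = e then 1 else 0) * (if b = c then 1 else 0) -
      1 / d * ((if a = b then 1 else 0) * (if c = e then 1 else 0))) := by
    rw [← hadj, ← hcross]
    field_simp
    ring
  rw [h, hα, hβ]
  ring
end
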